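/- arXiv:2108.03664 — 3 statements merged into one kernel-verified Lean document; each statement's English description precedes it below -/
import Mathlib

section
/- The set T := ⋃_{b≥2} T_b of all real numbers that are Trott in some integer base b ≥ 2 has Hausdorff dimension strictly less than 1. -/
open Filter Topology

/-- Number of digits of `a` in base `b`. -/
def digLen (b a : ℕ) : ℕ := (Nat.digits b a).length

/-- Value of the finite continued fraction `[0; a₁, a₂, …, aₙ]`. -/
noncomputable def cfVal : List ℕ → ℝ
  | [] => 0
  | (h :: t) => 1 / ((h : ℝ) + cfVal t)

/-- `a` witnesses that `x` is a Trott number in base `b`: the `a i` (indexed from 0)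
are positive, `x` is the value of the infinite continued fraction `[0; a 0, a 1, …]`,
and the base-`b` expansion of `x` is the concatenation of the base-`b` digit strings
of the partial quotients. -/
def IsTrottWith (b : ℕ) (x : ℝ) (a : ℕ → ℕ) : Prop :=
  (∀ i, 0 < a i) ∧
  Tendsto (fun n => cfVal ((List.range n).map a)) atTop (𝓝 x) ∧
  x = ∑' i : ℕ, (a i : ℝ) / (b : ℝ) ^ (∑ j ∈ Finset.range (i + 1), digLen b (a j))

/-- `x` is a Trott number in base `b`. -/
def IsTrott (b : ℕ) (x : ℝ) : Prop := ∃ a, IsTrottWith b x a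

/-- The set of Trott numbers in base `b`. -/
def TrottSet (b : ℕ) : Set ℝ := {x | IsTrott b x}

/-! ### Tails of Trott numbers -/

/-- `y` is the value of the continued fraction `[0; a 0, a 1, …]` and `z` is the number whose
base-`b` expansion is the concatenation of the digit strings of the `a i`. -/
def IsTrottTail (b : ℕ) (a : ℕ → ℕ) (y z : ℝ) : Prop :=
  (∀ i, 0 < a i) ∧
  Tendsto (fun n => cfVal ((List.range n).map a)) atTop (𝓝 y) ∧
  z = ∑' i : ℕ, (a i : ℝ) / (b : ℝ) ^ (∑ j ∈ Finset.range (i + 1), digLen b (a j))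

lemma cfVal_mem_Icc : ∀ l : List ℕ, (∀ n ∈ l, 0 < n) → cfVal l ∈ Set.Icc (0 : ℝ) 1
  | [], _ => by simp [cfVal]
  | h :: t, hl => by
    have ht := cfVal_mem_Icc t fun n hn => hl n (List.mem_cons_of_mem _ hn)
    have hh : (1 : ℝ) ≤ h := by exact_mod_cast hl h List.mem_cons_self
    have h0 := ht.1
    refine ⟨?_, ?_⟩
    · simp only [cfVal]; positivity
    · simp only [cfVal]
      rw [div_le_one (by linarith)]
      linarith

lemma cfVal_map_range_succ (a : ℕ → ℕ) (n : ℕ) :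
    cfVal ((List.range (n + 1)).map a) =
      1 / ((a 0 : ℝ) + cfVal ((List.range n).map fun i => a (i + 1))) := by
  rw [List.range_succ_eq_map, List.map_cons, List.map_map]
  rfl

lemma cfVal_map_range_mem_Icc {a : ℕ → ℕ} (ha : ∀ i, 0 < a i) (n : ℕ) :
    cfVal ((List.range n).map a) ∈ Set.Icc (0 : ℝ) 1 :=
  cfVal_mem_Icc _ fun m hm => by
    obtain ⟨i, -, rfl⟩ := List.mem_map.1 hm
    exact ha i

lemma tendsto_cfVal_mem_Icc {a : ℕ → ℕ} {y : ℝ} (ha : ∀ i, 0 < a i)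
    (h : Tendsto (fun n => cfVal ((List.range n).map a)) atTop (𝓝 y)) :
    y ∈ Set.Icc (0 : ℝ) 1 :=
  isClosed_Icc.mem_of_tendsto h (Eventually.of_forall (cfVal_map_range_mem_Icc ha))

lemma tendsto_cfVal_shift {a : ℕ → ℕ} {y : ℝ} (ha : ∀ i, 0 < a i)
    (h : Tendsto (fun n => cfVal ((List.range n).map a)) atTop (𝓝 y)) :
    ∃ y', Tendsto (fun n => cfVal ((List.range n).map fun i => a (i + 1))) atTop (𝓝 y') ∧
      y * (a 0 + y') = 1 := by
  have hs : ∀ n, cfVal ((List.range n).map fun i => a (i + 1)) ∈ Set.Icc (0 : ℝ) 1 :=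
    cfVal_map_range_mem_Icc fun i => ha (i + 1)
  have h1 := h.comp (tendsto_add_atTop_nat 1)
  have ha0 : (0 : ℝ) < a 0 := by exact_mod_cast ha 0
  have hy : 1 / ((a 0 : ℝ) + 1) ≤ y := by
    refine ge_of_tendsto h1 (Eventually.of_forall fun n => ?_)
    simp only [Function.comp, cfVal_map_range_succ]
    have := hs n
    exact one_div_le_one_div_of_le (by linarith [this.1]) (by linarith [this.2])
  have hy0 : 0 < y := lt_of_lt_of_le (by positivity) hy
  refine ⟨y⁻¹ - a 0, ?_, ?_⟩
  · refine ((h1.inv₀ hy0.ne').sub_const (a 0 : ℝ)).congr fun n => ?_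
    simp [Function.comp, cfVal_map_range_succ]
  · rw [add_sub_cancel, mul_inv_cancel₀ hy0.ne']

lemma lt_pow_digLen {b : ℕ} (hb : 2 ≤ b) (n : ℕ) : n < b ^ digLen b n :=
  Nat.lt_base_pow_length_digits hb

lemma sum_div_pow_digLen_le {b : ℕ} (hb : 2 ≤ b) (a : ℕ → ℕ) (n : ℕ) :
    ∑ i ∈ Finset.range n,
        (a i : ℝ) / (b : ℝ) ^ (∑ j ∈ Finset.range (i + 1), digLen b (a j)) ≤
      1 - 1 / (b : ℝ) ^ (∑ j ∈ Finset.range n, digLen b (a j)) := by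
  have hb0 : (0 : ℝ) < b := by exact_mod_cast (by omega : 0 < b)
  induction n with
  | zero => simp
  | succ n ih =>
    rw [Finset.sum_range_succ]
    refine (add_le_add_left ih _).trans ?_
    rw [Finset.sum_range_succ _ n, pow_add]
    have h1 : (a n : ℝ) + 1 ≤ (b : ℝ) ^ digLen b (a n) := by
      exact_mod_cast lt_pow_digLen hb (a n)
    set P := (b : ℝ) ^ (∑ j ∈ Finset.range n, digLen b (a j))
    set Q := (b : ℝ) ^ digLen b (a n)
    have hP : 0 < P := by positivity
    have hQ : 0 < Q := by positivity
    have : ((a n : ℝ) + 1) / (P * Q) ≤ 1 / P := by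
      rw [div_le_div_iff₀ (by positivity) hP]
      nlinarith
    rw [add_div] at this
    linarith

lemma summable_div_pow_digLen {b : ℕ} (hb : 2 ≤ b) (a : ℕ → ℕ) :
    Summable fun i : ℕ =>
      (a i : ℝ) / (b : ℝ) ^ (∑ j ∈ Finset.range (i + 1), digLen b (a j)) :=
  summable_of_sum_range_le (c := 1) (fun _ => by positivity) fun n =>
    (sum_div_pow_digLen_le hb a n).trans (sub_le_self _ (by positivity))

namespace IsTrottTail

variable {b : ℕ} {a : ℕ → ℕ} {y z : ℝ}

lemma fst_mem_Icc (h : IsTrottTail b a y z) : y ∈ Set.Icc (0 : ℝ) 1 :=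
  tendsto_cfVal_mem_Icc h.1 h.2.1

lemma snd_mem_Icc (hb : 2 ≤ b) (h : IsTrottTail b a y z) : z ∈ Set.Icc (0 : ℝ) 1 := by
  rw [h.2.2]
  exact ⟨tsum_nonneg fun _ => by positivity,
    Real.tsum_le_of_sum_range_le (fun _ => by positivity) fun n =>
      (sum_div_pow_digLen_le hb a n).trans (sub_le_self _ (by positivity))⟩

lemma shift (hb : 2 ≤ b) (h : IsTrottTail b a y z) :
    ∃ y' z', IsTrottTail b (fun i => a (i + 1)) y' z' ∧ y * (a 0 + y') = 1 ∧
      z = (a 0 + z') / (b : ℝ) ^ digLen b (a 0) := by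
  obtain ⟨y', hy', hy⟩ := tendsto_cfVal_shift h.1 h.2.1
  refine ⟨y', _, ⟨fun i => h.1 (i + 1), hy', rfl⟩, hy, ?_⟩
  rw [h.2.2, (summable_div_pow_digLen hb a).tsum_eq_zero_add, add_div]
  congr 1
  rw [← tsum_div_const]
  refine tsum_congr fun i => ?_
  rw [Finset.sum_range_succ' _ (i + 1), pow_add, div_div]

end IsTrottTail

/-! ### Summation over the children of a continued fraction cylinder -/

/-- The proportion of a continued fraction cylinder with `q_{n-1} / q_n = r` occupied by the
sub-cylinder with next partial quotient `i + 1`. -/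
noncomputable def childRatio (r : ℝ) (i : ℕ) : ℝ := (1 + r) / ((i + 1 + r) * (i + 2 + r))

section childRatio

variable {r : ℝ}

lemma childRatio_pos (hr : 0 ≤ r) (i : ℕ) : 0 < childRatio r i := by
  unfold childRatio; positivity

lemma sum_childRatio (hr : 0 ≤ r) (n : ℕ) :
    ∑ i ∈ Finset.range n, childRatio r i = 1 - (1 + r) / (n + 1 + r) := by
  induction n with
  | zero =>
    have : 1 + r ≠ 0 := by positivity
    simp [this]
  | succ n ih =>
    rw [Finset.sum_range_succ, ih, childRatio]
    push_cast
    have h1 : (n : ℝ) + 1 + r ≠ 0 := by positivity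
    have h2 : (n : ℝ) + 2 + r ≠ 0 := by positivity
    have h3 : (n : ℝ) + 1 + 1 + r ≠ 0 := by positivity
    field_simp
    ring

lemma childRatio_le_half (hr : 0 ≤ r) (i : ℕ) : childRatio r i ≤ 1 / 2 := by
  unfold childRatio
  have hi : (0 : ℝ) ≤ i := i.cast_nonneg
  rw [div_le_div_iff₀ (by positivity) (by norm_num)]
  nlinarith [mul_nonneg hi hr, mul_nonneg hi hi, mul_nonneg hr hr]

lemma le_childRatio (hr : r ∈ Set.Icc (0 : ℝ) 1) (i : ℕ) :
    1 / ((i + 2) * (i + 3) : ℝ) ≤ childRatio r i := by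
  obtain ⟨h0, h1⟩ := hr
  have hi : (0 : ℝ) ≤ i := i.cast_nonneg
  exact div_le_div₀ (by positivity) (by linarith) (by positivity)
    (mul_le_mul (by linarith) (by linarith) (by positivity) (by positivity))

lemma childRatio_le (hr : r ∈ Set.Icc (0 : ℝ) 1) (i : ℕ) :
    childRatio r i ≤ 2 / (i + 1 : ℝ) ^ 2 := by
  obtain ⟨h0, h1⟩ := hr
  rw [sq]
  exact div_le_div₀ (by norm_num) (by linarith) (by positivity)
    (mul_le_mul (by linarith) (by linarith) (by positivity) (by positivity))

lemma childRatio_rpow_le (hr : 0 ≤ r) {σ : ℝ} (h0 : 0 ≤ σ) (h1 : σ ≤ 1) (i : ℕ) :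
    childRatio r i ^ σ ≤ childRatio r i + (1 - σ) := by
  have hp := (childRatio_pos hr i).le
  have := Real.geom_mean_le_arith_mean2_weighted h0 (sub_nonneg.2 h1) hp zero_le_one (by ring)
  rw [Real.one_rpow, mul_one, mul_one] at this
  nlinarith

lemma childRatio_rpow_le_tail (hr : r ∈ Set.Icc (0 : ℝ) 1) {σ : ℝ} (h0 : 3 / 4 ≤ σ) (i : ℕ) :
    childRatio r i ^ σ ≤ 2 * (1 / ((i + 1 : ℕ) : ℝ) ^ (3 / 2 : ℝ)) := by
  have hp := childRatio_pos hr.1 i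
  have hi : (0 : ℝ) < (i + 1 : ℕ) := by positivity
  calc childRatio r i ^ σ ≤ childRatio r i ^ (3 / 4 : ℝ) :=
        Real.rpow_le_rpow_of_exponent_ge hp
          ((childRatio_le_half hr.1 i).trans (by norm_num)) h0
    _ ≤ (2 / ((i + 1 : ℕ) : ℝ) ^ 2) ^ (3 / 4 : ℝ) := by
        refine Real.rpow_le_rpow hp.le ?_ (by norm_num)
        simpa using childRatio_le hr i
    _ = 2 ^ (3 / 4 : ℝ) * (1 / ((i + 1 : ℕ) : ℝ) ^ (3 / 2 : ℝ)) := by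
        rw [Real.div_rpow (by norm_num) (by positivity), ← Real.rpow_natCast,
          ← Real.rpow_mul hi.le]
        norm_num
        rfl
    _ ≤ 2 * (1 / ((i + 1 : ℕ) : ℝ) ^ (3 / 2 : ℝ)) := by
        refine mul_le_mul_of_nonneg_right ?_ (by positivity)
        calc (2 : ℝ) ^ (3 / 4 : ℝ) ≤ 2 ^ (1 : ℝ) :=
              Real.rpow_le_rpow_of_exponent_le (by norm_num) (by norm_num)
          _ = 2 := Real.rpow_one 2

lemma sum_childRatio_ite_le (hr : 0 ≤ r) (k n : ℕ) :
    ∑ i ∈ Finset.range n, (if i = k then 0 else childRatio r i) ≤ 1 - childRatio r k := by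
  have hnn : ∀ i, 0 ≤ if i = k then 0 else childRatio r i := fun i => by
    split_ifs
    exacts [le_rfl, (childRatio_pos hr i).le]
  have hk : k ∈ Finset.range (n + k + 1) := by simp
  calc ∑ i ∈ Finset.range n, (if i = k then 0 else childRatio r i)
      ≤ ∑ i ∈ Finset.range (n + k + 1), (if i = k then 0 else childRatio r i) :=
        Finset.sum_le_sum_of_subset_of_nonneg (by simp; omega) fun i _ _ => hnn i
    _ = ∑ i ∈ Finset.range (n + k + 1), (childRatio r i - if i = k then childRatio r k else 0) :=
        Finset.sum_congr rfl fun i _ => by split_ifs with h <;> simp [h]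
    _ = ∑ i ∈ Finset.range (n + k + 1), childRatio r i - childRatio r k := by
        rw [Finset.sum_sub_distrib, Finset.sum_ite_eq' _ k, if_pos hk]
    _ ≤ 1 - childRatio r k := by
        rw [sum_childRatio hr]
        have : 0 ≤ (1 + r) / (((n + k + 1 : ℕ) : ℝ) + 1 + r) := by positivity
        linarith

/-- Once a child with bounded index is discarded, the proportions of the remaining children,
raised to some uniform exponent less than one, still have sum at most one. -/
lemma exists_exponent_sum_childRatio_rpow_le (B : ℕ) :
    ∃ σ : ℝ, 0 < σ ∧ σ < 1 ∧ ∀ r ∈ Set.Icc (0 : ℝ) 1, ∀ k ≤ B, ∀ n : ℕ,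
      ∑ i ∈ Finset.range n, (if i = k then 0 else childRatio r i ^ σ) ≤ 1 := by
  set δ : ℝ := 1 / ((B + 2) * (B + 3)) with hδ
  have hδ0 : 0 < δ := by positivity
  set h : ℕ → ℝ := fun i => 2 * (1 / ((i + 1 : ℕ) : ℝ) ^ (3 / 2 : ℝ)) with hh
  have hh0 : ∀ i, 0 ≤ h i := fun i => by positivity
  have hsum : Summable h :=
    ((summable_nat_add_iff 1).2
      (Real.summable_one_div_nat_rpow.2 (by norm_num : (1 : ℝ) < 3 / 2))).mul_left 2
  obtain ⟨M, hM⟩ := ((tendsto_order.1 (tendsto_sum_nat_add h)).2 (δ / 2) (by positivity)).exists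
  have htail : ∀ n, ∑ i ∈ Finset.range n, (if i < M then 0 else h i) ≤ δ / 2 := fun n => by
    calc ∑ i ∈ Finset.range n, (if i < M then 0 else h i)
        ≤ ∑ i ∈ Finset.range (M + n), (if i < M then 0 else h i) :=
          Finset.sum_le_sum_of_subset_of_nonneg (by simp) fun i _ _ => by
            split_ifs
            exacts [le_rfl, hh0 i]
      _ = ∑ i ∈ Finset.range n, h (i + M) := by
          rw [Finset.sum_range_add, Finset.sum_eq_zero, zero_add]
          · exact Finset.sum_congr rfl fun i _ => by simp [add_comm]
          · intro i hi
            rw [if_pos (Finset.mem_range.1 hi)]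
      _ ≤ ∑' i, h (i + M) :=
          ((summable_nat_add_iff M).2 hsum).sum_le_tsum _ fun i _ => hh0 _
      _ ≤ δ / 2 := hM.le
  set η : ℝ := min (1 / 4) (δ / (2 * (M + 1))) with hη
  have hη0 : 0 < η := lt_min (by norm_num) (by positivity)
  have hη1 : η ≤ 1 / 4 := min_le_left _ _
  have hηM : M * η ≤ δ / 2 := by
    have h1 : η ≤ δ / (2 * (M + 1)) := min_le_right _ _
    rw [le_div_iff₀ (by positivity)] at h1
    nlinarith
  refine ⟨1 - η, by linarith, by linarith, fun r hr k hk n => ?_⟩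
  have hterm : ∀ i, (if i = k then 0 else childRatio r i ^ (1 - η)) ≤
      (if i = k then 0 else childRatio r i) + (if i < M then η else 0) +
        (if i < M then 0 else h i) := fun i => by
    have hp := (childRatio_pos hr.1 i).le
    have h1 := childRatio_rpow_le hr.1 (σ := 1 - η) (by linarith) (by linarith) i
    have h2 := childRatio_rpow_le_tail hr (σ := 1 - η) (by linarith) i
    have h3 := hh0 i
    split_ifs <;> linarith
  have hfew : ∑ i ∈ Finset.range n, (if i < M then η else 0) ≤ M * η := by
    rw [← Finset.sum_filter, Finset.sum_const, nsmul_eq_mul]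
    refine mul_le_mul_of_nonneg_right ?_ hη0.le
    have : (Finset.range n).filter (· < M) ⊆ Finset.range M := fun i hi => by
      simpa using (Finset.mem_filter.1 hi).2
    simpa using Finset.card_le_card this
  have hkδ : δ ≤ childRatio r k := by
    refine le_trans ?_ (le_childRatio hr k)
    have : (k : ℝ) ≤ B := by exact_mod_cast hk
    rw [hδ]
    gcongr
  calc ∑ i ∈ Finset.range n, (if i = k then 0 else childRatio r i ^ (1 - η))
      ≤ _ := Finset.sum_le_sum fun i _ => hterm i
    _ ≤ 1 := by
      rw [Finset.sum_add_distrib, Finset.sum_add_distrib]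
      linarith [htail n, sum_childRatio_ite_le hr.1 k n]

end childRatio

/-! ### Cylinders of Trott numbers -/

/-- Data of a cylinder: the coefficients of the fractional linear map `y ↦ (p + pPrev y) / (q + qPrev y)`
prepending a finite word to a continued fraction, and those of the affine map `z ↦ c + d z`
prepending its digit string to an expansion. -/
structure CylData where
  /-- Numerator of the last convergent. -/
  p : ℝ
  /-- Numerator of the previous convergent. -/
  pPrev : ℝ
  /-- Denominator of the last convergent. -/
  q : ℝ
  /-- Denominator of the previous convergent. -/
  qPrev : ℝ
  /-- Value of the digit string. -/
  c : ℝ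
  /-- Place value of the last digit. -/
  d : ℝ

namespace CylData

/-- The data of the empty word. -/
def root : CylData := ⟨0, 1, 1, 0, 0, 1⟩

/-- The data obtained by appending the partial quotient `i + 1`. -/
noncomputable def child (b : ℕ) (s : CylData) (i : ℕ) : CylData where
  p := s.p * (i + 1) + s.pPrev
  pPrev := s.p
  q := s.q * (i + 1) + s.qPrev
  qPrev := s.q
  c := s.c + s.d * (i + 1) / (b : ℝ) ^ digLen b (i + 1)
  d := s.d / (b : ℝ) ^ digLen b (i + 1)

/-- The properties of cylinder data used in the estimates. -/
structure Valid (s : CylData) : Prop where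
  q_pos : 0 < s.q
  qPrev_nonneg : 0 ≤ s.qPrev
  qPrev_le : s.qPrev ≤ s.q
  det_sq : (s.pPrev * s.q - s.p * s.qPrev) ^ 2 = 1

/-- The Trott numbers in base `b` in the cylinder. -/
def carrier (b : ℕ) (s : CylData) : Set ℝ :=
  {x | ∃ a y z, IsTrottTail b a y z ∧ x * (s.q + s.qPrev * y) = s.p + s.pPrev * y ∧ x = s.c + s.d * z}

/-- The length of the continued fraction cylinder. -/
noncomputable def width (s : CylData) : ℝ := 1 / (s.q * (s.q + s.qPrev))

lemma root_valid : root.Valid := by constructor <;> norm_num [root]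

lemma width_root : root.width = 1 := by norm_num [width, root]

lemma mem_carrier_root {b : ℕ} {x : ℝ} (h : IsTrott b x) : x ∈ root.carrier b := by
  obtain ⟨a, ha⟩ := h
  exact ⟨a, x, x, ha, by simp [root], by simp [root]⟩

variable {b : ℕ} {s : CylData}

lemma Valid.child (h : s.Valid) (b i : ℕ) : (s.child b i).Valid where
  q_pos := by
    have := h.q_pos
    have := h.qPrev_nonneg
    simp only [CylData.child]
    positivity
  qPrev_nonneg := h.q_pos.le
  qPrev_le := by
    have := h.q_pos
    have := h.qPrev_nonneg
    simp only [CylData.child]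
    nlinarith [mul_nonneg h.q_pos.le (i.cast_nonneg : (0 : ℝ) ≤ i)]
  det_sq := by
    rw [← h.det_sq]
    simp only [CylData.child]
    ring

lemma Valid.width_pos (h : s.Valid) : 0 < s.width := by
  have := h.q_pos
  have := h.qPrev_nonneg
  unfold width
  positivity

lemma Valid.ratio_mem (h : s.Valid) : s.qPrev / s.q ∈ Set.Icc (0 : ℝ) 1 :=
  ⟨div_nonneg h.qPrev_nonneg h.q_pos.le, (div_le_one h.q_pos).2 h.qPrev_le⟩

lemma Valid.width_child (h : s.Valid) (b i : ℕ) :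
    (s.child b i).width = s.width * childRatio (s.qPrev / s.q) i := by
  have h1 := h.q_pos
  have h2 := h.qPrev_nonneg
  simp only [width, CylData.child, childRatio]
  have h3 : s.q + s.qPrev ≠ 0 := by positivity
  have h4 : s.q * (i + 1) + s.qPrev ≠ 0 := by positivity
  have h5 : s.q * (i + 1) + s.qPrev + s.q ≠ 0 := by positivity
  have h6 : s.q * (i + 2) + s.qPrev ≠ 0 := by positivity
  field_simp
  ring

lemma carrier_subset_iUnion_child (hb : 2 ≤ b) (s : CylData) :
    s.carrier b ⊆ ⋃ i, (s.child b i).carrier b := by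
  rintro x ⟨a, y, z, h, hy, hz⟩
  obtain ⟨y', z', h', hyy, hzz⟩ := h.shift hb
  refine Set.mem_iUnion.2 ⟨a 0 - 1, _, y', z', h', ?_, ?_⟩
  · have ha : ((a 0 - 1 : ℕ) : ℝ) + 1 = a 0 := by
      exact_mod_cast Nat.sub_add_cancel (h.1 0)
    simp only [child, ha]
    linear_combination (a 0 + y') * hy + (s.pPrev - x * s.qPrev) * hyy
  · have ha : ((a 0 - 1 : ℕ) : ℝ) + 1 = a 0 := by
      exact_mod_cast Nat.sub_add_cancel (h.1 0)
    have ha' : a 0 - 1 + 1 = a 0 := Nat.sub_add_cancel (h.1 0)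
    simp only [child, ha, ha']
    rw [hz, hzz]
    ring

lemma Valid.ediam_carrier_le (h : s.Valid) (b : ℕ) :
    Metric.ediam (s.carrier b) ≤ ENNReal.ofReal s.width := by
  have hq := h.q_pos
  have hq' := h.qPrev_nonneg
  have hdet : |s.pPrev * s.q - s.p * s.qPrev| = 1 := by
    rw [← sq_eq_sq₀ (abs_nonneg _) zero_le_one, sq_abs, h.det_sq, one_pow]
  refine Metric.ediam_le fun x hx x' hx' => ?_
  rw [edist_dist, Real.dist_eq]
  refine ENNReal.ofReal_le_ofReal ?_
  obtain ⟨a, y, z, ht, hy, -⟩ := hx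
  obtain ⟨a', y', z', ht', hy', -⟩ := hx'
  obtain ⟨y0, y1⟩ := ht.fst_mem_Icc
  obtain ⟨y0', y1'⟩ := ht'.fst_mem_Icc
  have hA : 0 < s.q + s.qPrev * y := by positivity
  have hA' : 0 < s.q + s.qPrev * y' := by positivity
  have hdiff : x - x' =
      (s.pPrev * s.q - s.p * s.qPrev) * ((y - y') / ((s.q + s.qPrev * y) * (s.q + s.qPrev * y'))) := by
    rw [eq_div_of_mul_eq hA.ne' hy, eq_div_of_mul_eq hA'.ne' hy']
    field_simp
    ring
  rw [hdiff, abs_mul, hdet, one_mul, abs_div, abs_of_pos (mul_pos hA hA'), width,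
    div_le_div_iff₀ (mul_pos hA hA') (by positivity)]
  have key : ∀ u v : ℝ, 0 ≤ u → u ≤ 1 → 0 ≤ v → v ≤ 1 →
      (u - v) * (s.q * (s.q + s.qPrev)) ≤ 1 * ((s.q + s.qPrev * u) * (s.q + s.qPrev * v)) := by
    intro u v hu hu1 hv hv1
    have e : 1 * ((s.q + s.qPrev * u) * (s.q + s.qPrev * v)) - (u - v) * (s.q * (s.q + s.qPrev)) =
      s.q ^ 2 * (1 - u + v) + s.q * s.qPrev * (2 * v) + s.qPrev ^ 2 * (u * v) := by ring
    have : 0 ≤ s.q ^ 2 * (1 - u + v) + s.q * s.qPrev * (2 * v) + s.qPrev ^ 2 * (u * v) := by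
      have : 0 ≤ 1 - u + v := by linarith
      positivity
    linarith
  rcases abs_cases (y - y') with ⟨e, -⟩ | ⟨e, -⟩ <;> rw [e]
  · exact key y y' y0 y1 y0' y1'
  · have := key y' y y0' y1' y0 y1
    linarith

end CylData

/-! ### Excluded children -/

/-- The affine progression of the digit cylinders cannot follow the hyperbola along which the
continued fraction cylinders are arranged. -/
lemma affine_not_near_hyperbola {N K α β g₁ g₂ g₃ t₁ t₂ t₃ θ₁ θ₂ θ₃ : ℝ} (hN : 100 ≤ N)
    (hK : N - 2 ≤ 2 * K) (hK' : 2 * K ≤ N)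
    (ht₁ : t₁ ∈ Set.Icc N (N + 2)) (ht₂ : t₂ ∈ Set.Icc (N + K) (N + K + 2))
    (ht₃ : t₃ ∈ Set.Icc (N + 2 * K) (N + 2 * K + 2))
    (hg₁ : g₁ * t₁ = 1) (hg₂ : g₂ * t₂ = 1) (hg₃ : g₃ * t₃ = 1)
    (hθ₁ : θ₁ ∈ Set.Icc (0 : ℝ) 1) (hθ₂ : θ₂ ∈ Set.Icc (0 : ℝ) 1)
    (hθ₃ : θ₃ ∈ Set.Icc (0 : ℝ) 1)
    (e₁ : g₁ = α + β * (N + θ₁)) (e₂ : g₂ = α + β * (N + K + θ₂))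
    (e₃ : g₃ = α + β * (N + 2 * K + θ₃)) : False := by
  obtain ⟨t₁l, t₁u⟩ := ht₁
  obtain ⟨t₂l, t₂u⟩ := ht₂
  obtain ⟨t₃l, t₃u⟩ := ht₃
  obtain ⟨θ₁l, θ₁u⟩ := hθ₁
  obtain ⟨θ₂l, θ₂u⟩ := hθ₂
  obtain ⟨θ₃l, θ₃u⟩ := hθ₃
  have G₁ : g₁ = 1 / t₁ := eq_div_of_mul_eq (by linarith) hg₁
  have G₂ : g₂ = 1 / t₂ := eq_div_of_mul_eq (by linarith) hg₂
  have G₃ : g₃ = 1 / t₃ := eq_div_of_mul_eq (by linarith) hg₃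
  have l₁ : 1 / (N + 2) ≤ g₁ := by
    rw [G₁]; exact one_div_le_one_div_of_le (by linarith) (by linarith)
  have u₁ : g₁ ≤ 1 / N := by
    rw [G₁]; exact one_div_le_one_div_of_le (by linarith) (by linarith)
  have u₂ : g₂ ≤ 1 / (3 / 2 * N - 1) := by
    rw [G₂]; exact one_div_le_one_div_of_le (by linarith) (by linarith)
  have l₃ : 1 / (2 * N + 2) ≤ g₃ := by
    rw [G₃]; exact one_div_le_one_div_of_le (by linarith) (by linarith)
  have l₃' : 0 ≤ g₃ := le_trans (by positivity) l₃
  have hslope : -β * (2 * K + θ₃ - θ₁) ≤ 1 / N := by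
    have : -β * (2 * K + θ₃ - θ₁) = g₁ - g₃ := by rw [e₁, e₃]; ring
    linarith
  have hneg : β ≤ 0 := by
    have h13 : g₃ ≤ g₁ := by
      rw [G₁, G₃]; exact one_div_le_one_div_of_le (by linarith) (by linarith)
    have : β * (2 * K + θ₃ - θ₁) ≤ 0 := by
      have : β * (2 * K + θ₃ - θ₁) = g₃ - g₁ := by rw [e₁, e₃]; ring
      linarith
    by_contra! hβ
    nlinarith [mul_pos hβ (by linarith : 0 < 2 * K + θ₃ - θ₁)]
  have hβ : -β ≤ 1 / (N * (N - 3)) := by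
    rw [← div_div, le_div_iff₀ (by linarith)]
    refine le_trans ?_ hslope
    exact mul_le_mul_of_nonneg_left (by linarith) (by linarith)
  have hsecond : g₁ + g₃ - 2 * g₂ ≤ 2 * (1 / (N * (N - 3))) := by
    have : g₁ + g₃ - 2 * g₂ = -β * (2 * θ₂ - θ₁ - θ₃) := by rw [e₁, e₂, e₃]; ring
    have : -β * (2 * θ₂ - θ₁ - θ₃) ≤ -β * 2 :=
      mul_le_mul_of_nonneg_left (by linarith) (by linarith)
    linarith
  have hnum : 2 * (1 / (N * (N - 3))) + 2 * (1 / (3 / 2 * N - 1)) <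
      1 / (N + 2) + 1 / (2 * N + 2) := by
    obtain ⟨m, rfl⟩ : ∃ m, N = m + 100 := ⟨N - 100, by ring⟩
    have hm : 0 ≤ m := by linarith
    have w₁ : 0 < (m + 100) * (m + 100 - 3) := mul_pos (by linarith) (by linarith)
    have w₂ : 0 < 3 / 2 * (m + 100) - 1 := by linarith
    rw [← sub_pos]
    have : 1 / (m + 100 + 2) + 1 / (2 * (m + 100) + 2) -
        (2 * (1 / ((m + 100) * (m + 100 - 3))) + 2 * (1 / (3 / 2 * (m + 100) - 1))) =
        (((2 * (m + 100) + 2) + (m + 100 + 2)) * ((m + 100) * (m + 97)) *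
            (3 / 2 * m + 149) -
          (2 * (3 / 2 * m + 149) + 2 * ((m + 100) * (m + 97))) *
            ((m + 102) * (2 * m + 202))) /
        ((m + 102) * (2 * m + 202) * ((m + 100) * (m + 97)) * (3 / 2 * m + 149)) := by
      have a₁ : m + 100 + 2 = m + 102 := by ring
      have a₂ : 2 * (m + 100) + 2 = 2 * m + 202 := by ring
      have a₃ : m + 100 - 3 = m + 97 := by ring
      have a₄ : 3 / 2 * (m + 100) - 1 = 3 / 2 * m + 149 := by ring
      rw [a₁, a₂, a₃, a₄]
      field_simp
    rw [this]
    refine div_pos ?_ (by positivity)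
    ring_nf
    positivity
  linarith

/-- In every base, some block of the form `[N, 2 N)` consists of integers with equally many
digits, where `N` is large but bounded independently of the base. -/
lemma exists_block_digLen {b : ℕ} (hb : 2 ≤ b) :
    ∃ N ℓ : ℕ, 100 ≤ N ∧ N ≤ 200 ^ 7 ∧ ∀ n, N ≤ n → n < 2 * N → digLen b n = ℓ := by
  have hlen : ∀ k n, b ^ k ≤ n → n < b ^ (k + 1) → digLen b n = k + 1 := fun k n h1 h2 =>
    le_antisymm ((Nat.digits_length_le_iff hb n).2 h2) ((Nat.lt_digits_length_iff hb n).2 h1)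
  by_cases hb' : 200 ≤ b
  · refine ⟨100, 1, le_rfl, by norm_num, fun n h1 h2 => hlen 0 n ?_ ?_⟩
    · rw [pow_zero]; omega
    · rw [zero_add, pow_one]; omega
  · refine ⟨b ^ 7, 8, ?_, Nat.pow_le_pow_left (by omega) 7, fun n h1 h2 => hlen 7 n h1 ?_⟩
    · calc 100 ≤ 2 ^ 7 := by norm_num
        _ ≤ b ^ 7 := Nat.pow_le_pow_left hb 7
    · rw [pow_succ']
      exact h2.trans_le (Nat.mul_le_mul_right _ hb)

namespace CylData

variable {b : ℕ} {s : CylData}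

/-- A point of the cylinder with next partial quotient `i + 1`, in coordinates in which the
continued fraction cylinders are arranged along a fixed hyperbola. -/
lemma Valid.coords_of_mem_child (hb : 2 ≤ b) (h : s.Valid) {i : ℕ} {x : ℝ}
    (hx : x ∈ (s.child b i).carrier b) :
    ∃ g t θ : ℝ, t ∈ Set.Icc ((i : ℝ) + 1) (i + 1 + 2) ∧ θ ∈ Set.Icc (0 : ℝ) 1 ∧ g * t = 1 ∧
      g = (s.pPrev * s.q - s.p * s.qPrev) * s.q * (s.q * s.c - s.p) +
        (s.pPrev * s.q - s.p * s.qPrev) * s.q ^ 2 * s.d / (b : ℝ) ^ digLen b (i + 1) *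
          (i + 1 + θ) := by
  obtain ⟨a, y, z, ht, hy, hz⟩ := hx
  obtain ⟨r0, r1⟩ := h.ratio_mem
  obtain ⟨y0, y1⟩ := ht.fst_mem_Icc
  have hq := h.q_pos.ne'
  refine ⟨(s.pPrev * s.q - s.p * s.qPrev) * s.q * (s.q * x - s.p), i + 1 + y + s.qPrev / s.q, z,
    ⟨by linarith, by linarith⟩, ht.snd_mem_Icc hb, ?_, ?_⟩
  · simp only [CylData.child] at hy
    have hdet := h.det_sq
    have : s.q * (i + 1 + y + s.qPrev / s.q) = s.q * (i + 1 + y) + s.qPrev := by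
      field_simp
    calc _ = (s.pPrev * s.q - s.p * s.qPrev) * (s.q * x - s.p) *
          (s.q * (i + 1 + y + s.qPrev / s.q)) := by ring
      _ = 1 := by
        rw [this]
        linear_combination (s.pPrev * s.q - s.p * s.qPrev) * s.q * hy + hdet
  · simp only [CylData.child] at hz
    rw [hz]
    ring

lemma Valid.exists_child_carrier_eq_empty (hb : 2 ≤ b) (h : s.Valid) :
    ∃ k ≤ 2 * 200 ^ 7, (s.child b k).carrier b = ∅ := by
  obtain ⟨N, ℓ, hN, hN', hlen⟩ := exists_block_digLen hb
  by_contra! hne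
  set K := (N - 1) / 2
  obtain ⟨x₁, hx₁⟩ := hne (N - 1) (by omega)
  obtain ⟨x₂, hx₂⟩ := hne (N - 1 + K) (by omega)
  obtain ⟨x₃, hx₃⟩ := hne (N - 1 + 2 * K) (by omega)
  obtain ⟨g₁, t₁, θ₁, ht₁, hθ₁, hg₁, e₁⟩ := h.coords_of_mem_child hb hx₁
  obtain ⟨g₂, t₂, θ₂, ht₂, hθ₂, hg₂, e₂⟩ := h.coords_of_mem_child hb hx₂
  obtain ⟨g₃, t₃, θ₃, ht₃, hθ₃, hg₃, e₃⟩ := h.coords_of_mem_child hb hx₃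
  rw [hlen _ (by omega) (by omega)] at e₁ e₂ e₃
  have c₁ : ((N - 1 : ℕ) : ℝ) + 1 = N := by
    exact_mod_cast (by omega : N - 1 + 1 = N)
  have c₂ : ((N - 1 + K : ℕ) : ℝ) + 1 = N + K := by
    exact_mod_cast (by omega : N - 1 + K + 1 = N + K)
  have c₃ : ((N - 1 + 2 * K : ℕ) : ℝ) + 1 = N + 2 * K := by
    exact_mod_cast (by omega : N - 1 + 2 * K + 1 = N + 2 * K)
  rw [c₁] at ht₁ e₁
  rw [c₂] at ht₂ e₂
  rw [c₃] at ht₃ e₃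
  have hK : (N : ℝ) ≤ 2 * K + 2 := by exact_mod_cast (by omega : N ≤ 2 * K + 2)
  have hK' : (2 : ℝ) * K ≤ N := by exact_mod_cast (by omega : 2 * K ≤ N)
  exact affine_not_near_hyperbola (by exact_mod_cast hN) (by linarith) hK' ht₁ ht₂ ht₃
    hg₁ hg₂ hg₃ hθ₁ hθ₂ hθ₃ e₁ e₂ e₃

end CylData

/-! ### The covering argument -/

open MeasureTheory Measure

namespace CylData

lemma Valid.tsum_width_child_le {σ : ℝ} {B k : ℕ} {s : CylData} (h : s.Valid) (hk : k ≤ B)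
    (hσ : ∀ r ∈ Set.Icc (0 : ℝ) 1, ∀ k ≤ B, ∀ n : ℕ,
      ∑ i ∈ Finset.range n, (if i = k then 0 else childRatio r i ^ σ) ≤ 1) (b : ℕ) :
    ∑' i, (if i = k then 0 else ENNReal.ofReal ((s.child b i).width ^ σ)) ≤
      ENNReal.ofReal (s.width ^ σ) := by
  have hw := h.width_pos
  have hr := h.ratio_mem
  have hterm : ∀ i, (if i = k then 0 else ENNReal.ofReal ((s.child b i).width ^ σ)) =
      ENNReal.ofReal (s.width ^ σ * if i = k then 0 else childRatio (s.qPrev / s.q) i ^ σ) := by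
    intro i
    split_ifs
    · simp
    · rw [h.width_child, Real.mul_rpow hw.le (childRatio_pos hr.1 i).le]
  have hnn : ∀ i, 0 ≤ s.width ^ σ * if i = k then 0 else childRatio (s.qPrev / s.q) i ^ σ := by
    intro i
    have := childRatio_pos hr.1 i
    split_ifs <;> positivity
  refine ENNReal.tsum_le_of_sum_range_le fun n => ?_
  rw [Finset.sum_congr rfl fun i _ => hterm i, ← ENNReal.ofReal_sum_of_nonneg fun i _ => hnn i,
    ← Finset.mul_sum]
  exact ENNReal.ofReal_le_ofReal
    (mul_le_of_le_one_right (by positivity) (hσ _ hr k hk n))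

lemma pre_carrier_le {σ : ℝ} (hσ0 : 0 < σ)
    (hσ : ∀ r ∈ Set.Icc (0 : ℝ) 1, ∀ k ≤ 2 * 200 ^ 7, ∀ n : ℕ,
      ∑ i ∈ Finset.range n, (if i = k then 0 else childRatio r i ^ σ) ≤ 1)
    {b : ℕ} (hb : 2 ≤ b) {ε : ℝ} (m : ℕ) :
    ∀ s : CylData, s.Valid → s.width ≤ 2 ^ m * ε →
      OuterMeasure.mkMetric'.pre (fun t : Set ℝ => Metric.ediam t ^ σ) (ENNReal.ofReal ε)
        (s.carrier b) ≤ ENNReal.ofReal (s.width ^ σ) := by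
  induction m with
  | zero =>
    intro s h hs
    have hd := h.ediam_carrier_le b
    rw [pow_zero, one_mul] at hs
    refine (OuterMeasure.mkMetric'.pre_le
      (hd.trans (ENNReal.ofReal_le_ofReal hs))).trans ?_
    rw [← ENNReal.ofReal_rpow_of_nonneg h.width_pos.le hσ0.le]
    exact ENNReal.rpow_le_rpow hd hσ0.le
  | succ m ih =>
    intro s h hs
    obtain ⟨k, hk, hempty⟩ := h.exists_child_carrier_eq_empty hb
    refine (measure_mono (carrier_subset_iUnion_child hb s)).trans ?_
    refine (measure_iUnion_le _).trans ?_
    refine le_trans (ENNReal.tsum_le_tsum fun i => ?_) (h.tsum_width_child_le hk hσ b)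
    split_ifs with hi
    · rw [hi, hempty, measure_empty]
    · refine ih _ (h.child b i) ?_
      rw [h.width_child]
      have := mul_le_mul_of_nonneg_left (childRatio_le_half h.ratio_mem.1 i) h.width_pos.le
      rw [pow_succ] at hs
      linarith

end CylData

lemma exists_exponent_hausdorffMeasure_trott_le :
    ∃ σ : ℝ, 0 < σ ∧ σ < 1 ∧ ∀ b : ℕ, 2 ≤ b → μH[σ] (TrottSet b) ≤ 1 := by
  obtain ⟨σ, hσ0, hσ1, hσ⟩ := exists_exponent_sum_childRatio_rpow_le (2 * 200 ^ 7)
  refine ⟨σ, hσ0, hσ1, fun b hb => ?_⟩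
  rw [hausdorffMeasure, ← OuterMeasure.coe_mkMetric, OuterMeasure.mkMetric,
    OuterMeasure.mkMetric'.eq_iSup_nat, OuterMeasure.iSup_apply]
  refine iSup_le fun n => ?_
  refine (measure_mono fun x hx => CylData.mem_carrier_root (b := b) hx).trans ?_
  have hε : ((n + 1 : ℕ) : ENNReal)⁻¹ = ENNReal.ofReal ((n + 1 : ℕ) : ℝ)⁻¹ := by
    rw [ENNReal.ofReal_inv_of_pos (by positivity), ENNReal.ofReal_natCast]
  have hmono := OuterMeasure.mkMetric'.mono_pre_nat
    (fun t : Set ℝ => Metric.ediam t ^ σ) n.le_succ (CylData.root.carrier b)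
  refine hmono.trans ?_
  beta_reduce
  rw [Nat.succ_eq_add_one, hε]
  refine (CylData.pre_carrier_le hσ0 hσ hb (n + 1) _ CylData.root_valid ?_).trans ?_
  · rw [CylData.width_root, ← div_eq_mul_inv, one_le_div (by positivity)]
    exact_mod_cast Nat.lt_two_pow_self.le
  · rw [CylData.width_root, Real.one_rpow, ENNReal.ofReal_one]

/-- The set `T = ⋃_{b ≥ 2} T_b` of numbers Trott in some base has Hausdorff dimension
strictly less than one. -/
theorem trott_union_dimH_lt_one :
    dimH {x : ℝ | ∃ b : ℕ, 2 ≤ b ∧ IsTrott b x} < 1 := by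
  obtain ⟨σ, hσ0, hσ1, hσ⟩ := exists_exponent_hausdorffMeasure_trott_le
  have hset : {x : ℝ | ∃ b : ℕ, 2 ≤ b ∧ IsTrott b x} = ⋃ b ∈ Set.Ici 2, TrottSet b := by
    ext x
    simp [TrottSet]
  rw [hset, dimH_bUnion (Set.to_countable _)]
  refine lt_of_le_of_lt (iSup₂_le fun b hb => ?_) (ENNReal.ofReal_lt_one.2 hσ1)
  refine dimH_le_of_hausdorffMeasure_ne_top (d := σ.toNNReal) ?_
  rw [Real.coe_toNNReal σ hσ0.le]
  exact ne_top_of_le_ne_top ENNReal.one_ne_top (hσ b hb)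
end

section
/- Let b ≥ 2 be an integer and let s be a real number with s > 1/2 such that ∑_{l=0}^∞ ∑_{m=1}^∞ (b^l·m + 1)^{−2s} ≤ 1. Then the Hausdorff dimension of the set T_b of Trott numbers in base b is at most s. -/
open Filter Topology

/-- `x` is the value of the infinite continued fraction `[0; a 0, a 1, …]` with positive
partial quotients. -/
def IsCFOf (a : ℕ → ℕ) (x : ℝ) : Prop :=
  (∀ i, 0 < a i) ∧ Tendsto (fun n => cfVal ((List.range n).map a)) atTop (𝓝 x)

theorem cfVal_nonneg (w : List ℕ) : 0 ≤ cfVal w := by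
  induction w with
  | nil => simp [cfVal]
  | cons h t ih => simp only [cfVal]; positivity

theorem cfVal_le_one (w : List ℕ) (hw : ∀ n ∈ w, 0 < n) : cfVal w ≤ 1 := by
  cases w with
  | nil => simp [cfVal]
  | cons h t =>
    have h1 : (1 : ℝ) ≤ h := by exact_mod_cast hw h (by simp)
    have h2 := cfVal_nonneg t
    simp only [cfVal]
    rw [div_le_one (by linarith)]
    linarith

namespace IsCFOf

variable {a a' : ℕ → ℕ} {x x' : ℝ}

theorem one_le (h : IsCFOf a x) (i : ℕ) : (1 : ℝ) ≤ a i := by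
  exact_mod_cast h.1 i

theorem exists_tail_nonneg (h : IsCFOf a x) :
    ∃ y, 0 ≤ y ∧ IsCFOf (fun i => a (i + 1)) y ∧ x = 1 / ((a 0 : ℝ) + y) := by
  obtain ⟨hpos, hx⟩ := h
  set u : ℕ → ℝ := fun n => cfVal ((List.range n).map fun i => a (i + 1)) with hu
  have hrec : ∀ n, cfVal ((List.range (n + 1)).map a) = 1 / ((a 0 : ℝ) + u n) := by
    intro n
    rw [List.range_succ_eq_map, List.map_cons, List.map_map]
    rfl
  have ha : (1 : ℝ) ≤ a 0 := by exact_mod_cast hpos 0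
  have hu0 : ∀ n, 0 ≤ u n := fun n => cfVal_nonneg _
  have hu1 : ∀ n, u n ≤ 1 := by
    intro n
    refine cfVal_le_one _ fun k hk => ?_
    obtain ⟨i, -, rfl⟩ := List.mem_map.1 hk
    exact hpos _
  have hlim : Tendsto (fun n => 1 / ((a 0 : ℝ) + u n)) atTop (𝓝 x) := by
    simpa only [hrec] using (tendsto_add_atTop_iff_nat 1).2 hx
  have hxpos : 0 < x := by
    have h1 : 1 / ((a 0 : ℝ) + 1) ≤ x :=
      ge_of_tendsto' hlim fun n =>
        one_div_le_one_div_of_le (by linarith [hu0 n]) (by linarith [hu1 n])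
    exact lt_of_lt_of_le (by positivity) h1
  have hulim : Tendsto u atTop (𝓝 (x⁻¹ - a 0)) := by
    refine ((hlim.inv₀ hxpos.ne').sub_const (a 0 : ℝ)).congr fun n => ?_
    simp
  refine ⟨x⁻¹ - a 0, ge_of_tendsto' hulim hu0, ⟨fun i => hpos _, hulim⟩, ?_⟩
  simp

theorem pos (h : IsCFOf a x) : 0 < x := by
  obtain ⟨y, hy, -, rfl⟩ := h.exists_tail_nonneg
  have := h.one_le 0
  positivity

theorem lt_one (h : IsCFOf a x) : x < 1 := by
  obtain ⟨y, -, hy, rfl⟩ := h.exists_tail_nonneg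
  have h0 := h.one_le 0
  have h1 := hy.pos
  rw [div_lt_one (by linarith)]
  linarith

theorem exists_tail (h : IsCFOf a x) :
    ∃ y, IsCFOf (fun i => a (i + 1)) y ∧ x = 1 / ((a 0 : ℝ) + y) := by
  obtain ⟨y, -, hy⟩ := h.exists_tail_nonneg
  exact ⟨y, hy⟩

/-- The value of a continued fraction is strictly decreasing in its odd-numbered
partial quotients (those of even index, counting from `0`). -/
theorem lt_of_even_lt (k : ℕ) (h : IsCFOf a x) (h' : IsCFOf a' x')
    (heq : ∀ i < 2 * k, a i = a' i) (hlt : a (2 * k) < a' (2 * k)) : x' < x := by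
  induction k generalizing a a' x x' with
  | zero =>
    obtain ⟨y, hy, rfl⟩ := h.exists_tail
    obtain ⟨y', hy', rfl⟩ := h'.exists_tail
    have h1 : (a 0 : ℝ) + 1 ≤ a' 0 := by exact_mod_cast hlt
    have := hy.lt_one
    have := hy.pos
    have := hy'.pos
    have := h.one_le 0
    exact one_div_lt_one_div_of_lt (by linarith) (by linarith)
  | succ k ih =>
    obtain ⟨y, hy, rfl⟩ := h.exists_tail
    obtain ⟨z, hz, rfl⟩ := hy.exists_tail
    obtain ⟨y', hy', rfl⟩ := h'.exists_tail
    obtain ⟨z', hz', rfl⟩ := hy'.exists_tail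
    have hzz : z' < z := ih hz hz' (fun i hi => heq _ (by omega)) hlt
    have := hz.pos
    have := hz'.pos
    have h0 := h.one_le 0
    have h1 := h.one_le 1
    rw [← heq 0 (by omega), zero_add, ← heq 1 (by omega)]
    have h2 : 1 / ((a 1 : ℝ) + z) < 1 / ((a 1 : ℝ) + z') :=
      one_div_lt_one_div_of_lt (by linarith) (by linarith)
    have h3 : 0 < 1 / ((a 1 : ℝ) + z) := by positivity
    exact one_div_lt_one_div_of_lt (by linarith) (by linarith)

end IsCFOf

theorem abs_sub_cf_two_step_le {m c z z' : ℝ} (hm : 0 < m) (hc : 0 < c) (hz : 0 ≤ z)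
    (hz' : 0 ≤ z') :
    |1 / (m + 1 / (c + z)) - 1 / (m + 1 / (c + z'))| ≤ (m * c + 1) ^ (-2 : ℤ) * |z - z'| := by
  have key : ∀ y : ℝ, 0 ≤ y → 1 / (m + 1 / (c + y)) = (c + y) / (m * (c + y) + 1) := by
    intro y hy
    field_simp
  have hd : 1 / (m + 1 / (c + z)) - 1 / (m + 1 / (c + z'))
      = ((m * (c + z) + 1) * (m * (c + z') + 1))⁻¹ * (z - z') := by
    rw [key z hz, key z' hz']
    field_simp
    ring
  rw [hd, abs_mul, abs_of_pos (by positivity)]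
  refine mul_le_mul_of_nonneg_right ?_ (abs_nonneg _)
  rw [zpow_neg, zpow_ofNat, sq]
  gcongr <;> linarith

/-- Two continued fractions sharing their first `2 * k` partial quotients are close. -/
theorem IsCFOf.abs_sub_le (k : ℕ) {a a' : ℕ → ℕ} {x x' : ℝ} (h : IsCFOf a x)
    (h' : IsCFOf a' x') (heq : ∀ i < 2 * k, a i = a' i) :
    |x - x'| ≤ ∏ i ∈ Finset.range k, ((a (2 * i) : ℝ) * a (2 * i + 1) + 1) ^ (-2 : ℤ) := by
  induction k generalizing a a' x x' with
  | zero =>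
    have := h.pos
    have := h'.pos
    have := h.lt_one
    have := h'.lt_one
    simp only [Finset.range_zero, Finset.prod_empty]
    rw [abs_le]
    constructor <;> linarith
  | succ k ih =>
    obtain ⟨y, hy, rfl⟩ := h.exists_tail
    obtain ⟨z, hz, rfl⟩ := hy.exists_tail
    obtain ⟨y', hy', rfl⟩ := h'.exists_tail
    obtain ⟨z', hz', rfl⟩ := hy'.exists_tail
    have hzz := ih hz hz' (fun i hi => heq _ (by omega))
    have h0 := h.one_le 0
    have h1 := h.one_le 1
    rw [← heq 0 (by omega), zero_add, ← heq 1 (by omega), Finset.prod_range_succ', mul_comm]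
    refine (abs_sub_cf_two_step_le (by linarith) (by linarith) hz.pos.le hz'.pos.le).trans ?_
    refine mul_le_mul_of_nonneg_left (hzz.trans_eq ?_) (by positivity)
    rfl

theorem abs_sub_one_div_add_le {n z z' : ℝ} (hn : 1 ≤ n) (hz : 0 ≤ z) (hz' : 0 ≤ z') :
    |1 / (n + z) - 1 / (n + z')| ≤ |z - z'| := by
  have hd : 1 / (n + z) - 1 / (n + z') = ((n + z) * (n + z'))⁻¹ * (z' - z) := by
    field_simp
    ring
  rw [hd, abs_mul, abs_of_pos (by positivity), abs_sub_comm z']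
  refine mul_le_of_le_one_left (abs_nonneg _) (inv_le_one_of_one_le₀ ?_)
  nlinarith

section Digits

variable {b : ℕ}

theorem term_le_sub (hb : 2 ≤ b) (a : ℕ → ℕ) (i : ℕ) :
    (a i : ℝ) / (b : ℝ) ^ (∑ j ∈ Finset.range (i + 1), digLen b (a j)) ≤
      ((b : ℝ) ^ (∑ j ∈ Finset.range i, digLen b (a j)))⁻¹ -
        ((b : ℝ) ^ (∑ j ∈ Finset.range (i + 1), digLen b (a j)))⁻¹ := by
  have hb0 : (0 : ℝ) < b := by positivity
  have h1 : (a i : ℝ) + 1 ≤ (b : ℝ) ^ digLen b (a i) := by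
    exact_mod_cast Nat.lt_base_pow_length_digits (m := a i) hb
  rw [Finset.sum_range_succ, pow_add, le_sub_iff_add_le]
  generalize (b : ℝ) ^ digLen b (a i) = L at *
  have hP : 0 < (b : ℝ) ^ (∑ j ∈ Finset.range i, digLen b (a j)) := by positivity
  generalize (b : ℝ) ^ (∑ j ∈ Finset.range i, digLen b (a j)) = P at *
  have hL : 0 < L := lt_of_lt_of_le (by positivity) h1
  have : (a i : ℝ) / (P * L) + (P * L)⁻¹ = (((a i : ℝ) + 1) / L) * P⁻¹ := by
    field_simp
  rw [this]
  exact mul_le_of_le_one_left (by positivity) ((div_le_one hL).2 h1)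

theorem sum_range_term_le (hb : 2 ≤ b) (a : ℕ → ℕ) (n N : ℕ) :
    ∑ i ∈ Finset.range N,
        (a (i + n) : ℝ) / (b : ℝ) ^ (∑ j ∈ Finset.range (i + n + 1), digLen b (a j)) ≤
      ((b : ℝ) ^ (∑ j ∈ Finset.range n, digLen b (a j)))⁻¹ := by
  have h := Finset.sum_le_sum fun i (_ : i ∈ Finset.range N) => term_le_sub hb a (i + n)
  have ht := Finset.sum_range_sub'
    (fun i => ((b : ℝ) ^ (∑ j ∈ Finset.range (i + n), digLen b (a j)))⁻¹) N
  simp only [add_right_comm _ 1 n, zero_add] at ht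
  rw [ht] at h
  refine h.trans (sub_le_self _ (by positivity))

theorem summable_term (hb : 2 ≤ b) (a : ℕ → ℕ) :
    Summable fun i : ℕ =>
      (a i : ℝ) / (b : ℝ) ^ (∑ j ∈ Finset.range (i + 1), digLen b (a j)) :=
  summable_of_sum_range_le (fun i => by positivity) fun N => sum_range_term_le hb a 0 N

/-- The value of a concatenated digit expansion is monotone in a block of fixed length. -/
theorem IsTrottWith.le_of_block_lt (hb : 2 ≤ b) {a a' : ℕ → ℕ} {x x' : ℝ} {n : ℕ}
    (h : IsTrottWith b x a) (h' : IsTrottWith b x' a') (heq : ∀ i < n, a i = a' i)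
    (hlen : digLen b (a n) = digLen b (a' n)) (hlt : a n < a' n) : x ≤ x' := by
  have hS : ∀ m ≤ n + 1, ∑ j ∈ Finset.range m, digLen b (a j) =
      ∑ j ∈ Finset.range m, digLen b (a' j) := by
    intro m hm
    refine Finset.sum_congr rfl fun j hj => ?_
    have hj := Finset.mem_range.1 hj
    rcases Nat.lt_or_ge j n with hjn | hjn
    · rw [heq j hjn]
    · rwa [show j = n by omega]
  have hprefix : ∑ i ∈ Finset.range n,
        (a i : ℝ) / (b : ℝ) ^ (∑ j ∈ Finset.range (i + 1), digLen b (a j)) =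
      ∑ i ∈ Finset.range n,
        (a' i : ℝ) / (b : ℝ) ^ (∑ j ∈ Finset.range (i + 1), digLen b (a' j)) := by
    refine Finset.sum_congr rfl fun i hi => ?_
    have hi := Finset.mem_range.1 hi
    rw [heq i hi, hS (i + 1) (by omega)]
  have htail : ∑' i : ℕ, (a (i + (n + 1)) : ℝ) /
        (b : ℝ) ^ (∑ j ∈ Finset.range (i + (n + 1) + 1), digLen b (a j)) ≤
      ((b : ℝ) ^ (∑ j ∈ Finset.range (n + 1), digLen b (a j)))⁻¹ :=
    Real.tsum_le_of_sum_range_le (fun i => by positivity) fun N =>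
      sum_range_term_le hb a (n + 1) N
  have hx' := (summable_term hb a').sum_le_tsum (Finset.range (n + 1))
    fun i _ => by positivity
  rw [← h'.2.2, Finset.sum_range_succ, ← hprefix, ← hS (n + 1) le_rfl] at hx'
  have hx := (summable_term hb a).sum_add_tsum_nat_add (n + 1)
  rw [← h.2.2, Finset.sum_range_succ] at hx
  have hmid : (a n : ℝ) / (b : ℝ) ^ (∑ j ∈ Finset.range (n + 1), digLen b (a j)) +
      ((b : ℝ) ^ (∑ j ∈ Finset.range (n + 1), digLen b (a j)))⁻¹ ≤
      (a' n : ℝ) / (b : ℝ) ^ (∑ j ∈ Finset.range (n + 1), digLen b (a j)) := by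
    rw [← one_div, ← add_div]
    have : (a n : ℝ) + 1 ≤ a' n := by exact_mod_cast hlt
    gcongr
  linarith

theorem IsTrottWith.isCFOf {a : ℕ → ℕ} {x : ℝ} (h : IsTrottWith b x a) : IsCFOf a x :=
  ⟨h.1, h.2.1⟩

/-- Trott numbers whose first partial quotient is `n`, and for which the partial quotients
`a (2 * i + 1)` and the lengths of `a (2 * i + 2)` are prescribed for `i < k`. -/
def trottCyl (b n k : ℕ) (t : Fin k → ℕ × ℕ) : Set ℝ :=
  {x | ∃ a, IsTrottWith b x a ∧ a 0 = n ∧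
    ∀ i : Fin k, a (2 * i + 1) = (t i).2 + 1 ∧ digLen b (a (2 * i + 2)) = (t i).1 + 1}

theorem eq_of_eq_of_digLen_eq (hb : 2 ≤ b) {k : ℕ} {a a' : ℕ → ℕ} {x x' : ℝ}
    (h : IsTrottWith b x a) (h' : IsTrottWith b x' a') (h0 : a 0 = a' 0)
    (hodd : ∀ i < k, a (2 * i + 1) = a' (2 * i + 1))
    (heven : ∀ i < k, digLen b (a (2 * i + 2)) = digLen b (a' (2 * i + 2))) :
    ∀ j ≤ 2 * k, a j = a' j := by
  intro j
  induction j using Nat.strong_induction_on with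
  | _ j ih =>
    intro hj
    rcases Nat.even_or_odd' j with ⟨i, rfl | rfl⟩
    · rcases i with _ | i
      · exact h0
      · have heq : ∀ r < 2 * (i + 1), a r = a' r := fun r hr => ih r hr (by omega)
        have hl := heven i (by omega)
        rcases lt_trichotomy (a (2 * (i + 1))) (a' (2 * (i + 1))) with hlt | he | hlt
        · exact absurd (h.le_of_block_lt hb h' heq hl hlt)
            (h.isCFOf.lt_of_even_lt (i + 1) h'.isCFOf heq hlt).not_ge
        · exact he
        · have heq' : ∀ r < 2 * (i + 1), a' r = a r := fun r hr => (heq r hr).symm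
          exact absurd (h'.le_of_block_lt hb h heq' hl.symm hlt)
            (h'.isCFOf.lt_of_even_lt (i + 1) h.isCFOf heq' hlt).not_ge
    · exact hodd i (by omega)

theorem pow_le_of_digLen_eq_succ (hb : 2 ≤ b) {n l : ℕ} (hn : 0 < n)
    (h : digLen b n = l + 1) : b ^ l ≤ n := by
  have h1 := Nat.base_pow_length_digits_le b n (by omega) hn.ne'
  rw [show (Nat.digits b n).length = l + 1 from h, pow_succ'] at h1
  exact Nat.le_of_mul_le_mul_left h1 (by omega)

theorem ediam_trottCyl_le (hb : 2 ≤ b) (n k : ℕ) (t : Fin k → ℕ × ℕ) :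
    Metric.ediam (trottCyl b n k t) ≤
      ENNReal.ofReal (∏ i, ((b : ℝ) ^ (t i).1 * ((t i).2 + 1) + 1) ^ (-2 : ℤ)) := by
  refine Metric.ediam_le fun x hx x' hx' => ?_
  obtain ⟨a, ha, ha0, hat⟩ := hx
  obtain ⟨a', ha', ha0', hat'⟩ := hx'
  rw [edist_dist, Real.dist_eq]
  refine ENNReal.ofReal_le_ofReal ?_
  have heq := eq_of_eq_of_digLen_eq hb ha ha' (ha0.trans ha0'.symm)
    (fun i hi => (hat ⟨i, hi⟩).1.trans (hat' ⟨i, hi⟩).1.symm)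
    (fun i hi => (hat ⟨i, hi⟩).2.trans (hat' ⟨i, hi⟩).2.symm)
  have h1 := ha.isCFOf.one_le 0
  obtain ⟨y, hy, rfl⟩ := ha.isCFOf.exists_tail
  obtain ⟨y', hy', rfl⟩ := ha'.isCFOf.exists_tail
  rw [← heq 0 (by omega)]
  refine (abs_sub_one_div_add_le h1 hy.pos.le hy'.pos.le).trans ?_
  refine (hy.abs_sub_le k hy' fun i hi => heq _ (by omega)).trans ?_
  rw [Finset.prod_range]
  refine Finset.prod_le_prod (fun i _ => by positivity) fun i _ => ?_
  have h2 : (b : ℝ) ^ (t i).1 ≤ a (2 * i + 1 + 1) := by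
    exact_mod_cast pow_le_of_digLen_eq_succ hb (ha.1 _) (hat i).2
  rw [(hat i).1, zpow_neg, zpow_neg, zpow_ofNat, zpow_ofNat, mul_comm]
  push_cast
  gcongr

theorem trottCyl_zero_subset_iUnion (n k : ℕ) (t₀ : Fin 0 → ℕ × ℕ) :
    trottCyl b n 0 t₀ ⊆ ⋃ t, trottCyl b n k t := by
  rintro x ⟨a, ha, ha0, -⟩
  refine Set.mem_iUnion.2
    ⟨fun i => (digLen b (a (2 * i + 2)) - 1, a (2 * i + 1) - 1), a, ha, ha0, fun i => ?_⟩
  have h1 := ha.1 (2 * i + 1)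
  have h2 : 0 < digLen b (a (2 * i + 2)) :=
    List.length_pos_iff.2 (Nat.digits_ne_nil_iff_ne_zero.2 (ha.1 _).ne')
  constructor <;> dsimp only <;> omega

end Digits

theorem ENNReal.tsum_fin_pi_prod {α : Type*} (f : α → ENNReal) (k : ℕ) :
    ∑' t : Fin k → α, ∏ i, f (t i) = (∑' p, f p) ^ k := by
  induction k with
  | zero => simp
  | succ k ih =>
    rw [← (Fin.consEquiv fun _ : Fin (k + 1) => α).tsum_eq, ENNReal.tsum_prod', pow_succ', ← ih,
      ← ENNReal.tsum_mul_right]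
    refine tsum_congr fun p => ?_
    rw [← ENNReal.tsum_mul_left]
    refine tsum_congr fun t => ?_
    simp [Fin.prod_univ_succ, Fin.consEquiv]

theorem summable_weight (b : ℕ) (hb : 2 ≤ b) (s : ℝ) (hs : 1 / 2 < s) :
    Summable fun p : ℕ × ℕ => ((b : ℝ) ^ p.1 * ((p.2 : ℝ) + 1) + 1) ^ (-(2 * s)) := by
  have hb0 : (0 : ℝ) < b := by positivity
  have hb1 : (1 : ℝ) < b := by exact_mod_cast hb
  have h1 : Summable fun l : ℕ => ((b : ℝ) ^ (-(2 * s))) ^ l :=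
    summable_geometric_of_lt_one (by positivity)
      (Real.rpow_lt_one_of_one_lt_of_neg hb1 (by linarith))
  have h2 : Summable fun m : ℕ => ((m : ℝ) + 1) ^ (-(2 * s)) := by
    have := (summable_nat_add_iff 1).2
      (Real.summable_nat_rpow (p := -(2 * s)) |>.2 (by linarith))
    simpa using this
  refine (h1.mul_of_nonneg h2 (fun _ => by positivity) fun _ => by positivity).of_nonneg_of_le
    (fun _ => by positivity) fun p => ?_
  have h3 : ((b : ℝ) ^ (-(2 * s))) ^ p.1 = ((b : ℝ) ^ p.1) ^ (-(2 * s)) := by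
    rw [← Real.rpow_natCast, ← Real.rpow_natCast, ← Real.rpow_mul hb0.le,
      ← Real.rpow_mul hb0.le, mul_comm]
  rw [h3, ← Real.mul_rpow (by positivity) (by positivity)]
  exact Real.rpow_le_rpow_of_nonpos (by positivity) (by linarith) (by linarith)

theorem ofReal_prod_zpow_rpow {ι : Type*} [Fintype ι] (w : ι → ℝ) (hw : ∀ i, 0 < w i) {s : ℝ}
    (hs : 0 ≤ s) :
    ENNReal.ofReal (∏ i, w i ^ (-2 : ℤ)) ^ s = ∏ i, ENNReal.ofReal (w i ^ (-(2 * s))) := by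
  have h0 : ∀ i, 0 ≤ w i ^ (-2 : ℤ) := fun i => (zpow_pos (hw i) _).le
  rw [ENNReal.ofReal_rpow_of_nonneg (Finset.prod_nonneg fun i _ => h0 i) hs,
    ← Real.finsetProd_rpow _ _ fun i _ => h0 i, ENNReal.ofReal_prod_of_nonneg]
  · refine Finset.prod_congr rfl fun i _ => ?_
    rw [← Real.rpow_intCast, ← Real.rpow_mul (hw i).le]
    congr 2
    push_cast
    ring
  · exact fun i _ => Real.rpow_nonneg (h0 i) _

theorem hausdorffMeasure_trottCyl_zero_le (b : ℕ) (hb : 2 ≤ b) (s : ℝ) (hs : 1 / 2 < s)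
    (hsum : ∑' (l : ℕ) (m : ℕ),
        ((b : ℝ) ^ l * ((m : ℝ) + 1) + 1) ^ (-(2 * s)) ≤ 1) (n : ℕ) (t₀ : Fin 0 → ℕ × ℕ) :
    MeasureTheory.Measure.hausdorffMeasure s (trottCyl b n 0 t₀) ≤ 1 := by
  have hb1 : (1 : ℝ) ≤ b := by exact_mod_cast (by omega : 1 ≤ b)
  have hE : ∑' p : ℕ × ℕ,
      ENNReal.ofReal (((b : ℝ) ^ p.1 * ((p.2 : ℝ) + 1) + 1) ^ (-(2 * s))) ≤ 1 := by
    have hsm := summable_weight b hb s hs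
    rw [← ENNReal.ofReal_tsum_of_nonneg (fun _ => by positivity) hsm, ENNReal.ofReal_le_one,
      hsm.tsum_prod]
    exact hsum
  have hr : Tendsto (fun k : ℕ => ENNReal.ofReal ((1 / 4 : ℝ) ^ k)) atTop (𝓝 0) := by
    have := tendsto_pow_atTop_nhds_zero_of_lt_one (r := (1 / 4 : ℝ)) (by norm_num) (by norm_num)
    simpa using ENNReal.tendsto_ofReal this
  refine (MeasureTheory.Measure.hausdorffMeasure_le_liminf_tsum s _ _ hr
    (fun k (t : Fin k → ℕ × ℕ) => trottCyl b n k t) (Eventually.of_forall fun k t => ?_)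
    (Eventually.of_forall fun k => trottCyl_zero_subset_iUnion n k t₀)).trans ?_
  · refine (ediam_trottCyl_le hb n k t).trans (ENNReal.ofReal_le_ofReal ?_)
    calc ∏ i, ((b : ℝ) ^ (t i).1 * ((t i).2 + 1) + 1) ^ (-2 : ℤ)
        ≤ ∏ _i : Fin k, (1 / 4 : ℝ) := by
          refine Finset.prod_le_prod (fun i _ => by positivity) fun i _ => ?_
          have h1 : (1 : ℝ) ≤ (b : ℝ) ^ (t i).1 := one_le_pow₀ hb1
          have h2 : (0 : ℝ) ≤ (t i).2 := by positivity
          have h3 : (2 : ℝ) ≤ (b : ℝ) ^ (t i).1 * ((t i).2 + 1) + 1 := by nlinarith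
          rw [zpow_neg, zpow_ofNat, one_div]
          exact inv_anti₀ (by norm_num) (by nlinarith)
      _ = (1 / 4) ^ k := by simp
  · refine liminf_le_of_le (by isBoundedDefault) fun c hc => ?_
    obtain ⟨k, hk⟩ := hc.exists
    refine hk.trans ?_
    calc ∑' t : Fin k → ℕ × ℕ, Metric.ediam (trottCyl b n k t) ^ s
        ≤ ∑' t : Fin k → ℕ × ℕ, ∏ i, ENNReal.ofReal
            (((b : ℝ) ^ (t i).1 * (((t i).2 : ℝ) + 1) + 1) ^ (-(2 * s))) := by
          refine ENNReal.tsum_le_tsum fun t => ?_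
          rw [← ofReal_prod_zpow_rpow _ (fun i => by positivity) (by linarith)]
          exact ENNReal.rpow_le_rpow (ediam_trottCyl_le hb n k t) (by linarith)
      _ = (∑' p : ℕ × ℕ, ENNReal.ofReal
            (((b : ℝ) ^ p.1 * ((p.2 : ℝ) + 1) + 1) ^ (-(2 * s)))) ^ k :=
          ENNReal.tsum_fin_pi_prod (fun p : ℕ × ℕ => ENNReal.ofReal
            (((b : ℝ) ^ p.1 * ((p.2 : ℝ) + 1) + 1) ^ (-(2 * s)))) k
      _ ≤ 1 := pow_le_one' hE k

/-- If `s > 1/2` and `∑_{l≥0} ∑_{m≥1} (bˡm + 1)^{-2s} ≤ 1`, then the Hausdorff dimension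
of the set of Trott numbers in base `b` is at most `s`. -/
theorem trottSet_dimH_le (b : ℕ) (hb : 2 ≤ b) (s : ℝ) (hs : 1 / 2 < s)
    (hsum : ∑' (l : ℕ) (m : ℕ),
        ((b : ℝ) ^ l * ((m : ℝ) + 1) + 1) ^ (-(2 * s)) ≤ 1) :
    dimH (TrottSet b) ≤ ENNReal.ofReal s := by
  have hsub : TrottSet b ⊆ ⋃ n, trottCyl b n 0 Fin.elim0 := by
    rintro x ⟨a, ha⟩
    exact Set.mem_iUnion.2 ⟨a 0, a, ha, rfl, fun i => i.elim0⟩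
  refine (dimH_mono hsub).trans ?_
  rw [dimH_iUnion]
  refine iSup_le fun n => dimH_le_of_hausdorffMeasure_ne_top (d := s.toNNReal) ?_
  rw [Real.coe_toNNReal _ (by linarith)]
  exact ne_top_of_le_ne_top ENNReal.one_ne_top
    (hausdorffMeasure_trottCyl_zero_le b hb s hs hsum n _)
end

section
/- For every integer b ≥ 2, no real number is a Trott number in both base b and base b+1; that is, T_b ∩ T_{b+1} = ∅. -/
open Filter Topology

/-! ### Continued fractions -/

lemma cfVal_mem_Icc_s9 (l : List ℕ) (hl : ∀ a ∈ l, 0 < a) : 0 ≤ cfVal l ∧ cfVal l ≤ 1 := by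
  induction l with
  | nil => simp [cfVal]
  | cons h t ih =>
    obtain ⟨h0, -⟩ := ih fun a ha => hl a (List.mem_cons_of_mem _ ha)
    have h1 : (1 : ℝ) ≤ h := by exact_mod_cast hl h List.mem_cons_self
    refine ⟨by simp only [cfVal]; positivity, ?_⟩
    simp only [cfVal]
    rw [div_le_one (by linarith)]
    linarith

/-- The continued fraction `[0; a 0, a 1, …]` converges to `x`. -/
def CfTendsto (a : ℕ → ℕ) (x : ℝ) : Prop :=
  Tendsto (fun n => cfVal ((List.range n).map a)) atTop (𝓝 x)

lemma CfTendsto.bounds {a : ℕ → ℕ} {x : ℝ} (h : CfTendsto a x) (ha : ∀ i, 0 < a i) :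
    0 < x ∧ x ≤ 1 := by
  have h' := (tendsto_add_atTop_iff_nat 1).2 h
  have hb (n : ℕ) := cfVal_mem_Icc_s9 ((List.range n).map fun i => a (i + 1))
    (by simp only [List.mem_map]; rintro _ ⟨i, -, rfl⟩; exact ha _)
  have h1 : (1 : ℝ) ≤ a 0 := by exact_mod_cast ha 0
  refine ⟨lt_of_lt_of_le (show (0 : ℝ) < 1 / (a 0 + 1) by positivity)
    (ge_of_tendsto' h' fun n => ?_), le_of_tendsto' h' fun n => ?_⟩
  · rw [cfVal_map_range_succ]
    exact one_div_le_one_div_of_le (by linarith [(hb n).1]) (by linarith [(hb n).2])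
  · rw [cfVal_map_range_succ, div_le_one (by linarith [(hb n).1])]
    linarith [(hb n).1]

lemma CfTendsto.shift {a : ℕ → ℕ} {x : ℝ} (h : CfTendsto a x) (ha : ∀ i, 0 < a i) :
    CfTendsto (fun i => a (i + 1)) (1 / x - a 0) := by
  have h' := (tendsto_add_atTop_iff_nat 1).2 h
  have h2 := (h'.inv₀ (h.bounds ha).1.ne').sub_const (a 0 : ℝ)
  rw [one_div]
  refine h2.congr fun n => ?_
  rw [cfVal_map_range_succ]
  simp

/-- The fractional remainder of an infinite continued fraction lies strictly in `(0, 1)`. -/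
lemma CfTendsto.remainder {a : ℕ → ℕ} {x : ℝ} (h : CfTendsto a x) (ha : ∀ i, 0 < a i) :
    0 < 1 / x - a 0 ∧ 1 / x - a 0 < 1 := by
  have hs := h.shift ha
  have ha' : ∀ i, 0 < a (i + 1) := fun i => ha _
  have hy := hs.bounds ha'
  refine ⟨hy.1, ?_⟩
  have hw := ((hs.shift ha').bounds fun i => ha _).1
  have h1 : (1 : ℝ) ≤ a (0 + 1) := by exact_mod_cast ha _
  have : 1 < 1 / (1 / x - (a 0 : ℝ)) := by linarith
  rwa [lt_div_iff₀ hy.1, one_mul] at this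

/-- The first partial quotient is determined by the value. -/
lemma CfTendsto.head_unique {a c : ℕ → ℕ} {x : ℝ} (h : CfTendsto a x) (ha : ∀ i, 0 < a i)
    (h' : CfTendsto c x) (hc : ∀ i, 0 < c i) : a 0 = c 0 := by
  have h1 := h.remainder ha
  have h2 := h'.remainder hc
  have e1 : (a 0 : ℝ) < c 0 + 1 := by linarith
  have e2 : (c 0 : ℝ) < a 0 + 1 := by linarith
  have e1' : a 0 < c 0 + 1 := by exact_mod_cast e1
  have e2' : c 0 < a 0 + 1 := by exact_mod_cast e2
  omega

/-! ### Concatenated digit expansions -/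

/-- The `i`-th term of the concatenated base-`b` expansion of the sequence `a`. -/
noncomputable def concatTerm (b : ℕ) (a : ℕ → ℕ) (i : ℕ) : ℝ :=
  (a i : ℝ) / (b : ℝ) ^ (∑ j ∈ Finset.range (i + 1), digLen b (a j))

lemma exists_digLen_eq_succ {b : ℕ} (hb : 2 ≤ b) {n : ℕ} (hn : 0 < n) :
    ∃ k, digLen b n = k + 1 ∧ b ^ k ≤ n := by
  obtain ⟨k, hk⟩ : ∃ k, digLen b n = k + 1 := by
    apply Nat.exists_eq_succ_of_ne_zero
    intro h
    have := lt_pow_digLen hb n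
    rw [h] at this
    simp at this
    omega
  refine ⟨k, hk, (Nat.lt_digits_length_iff (by omega : 1 < b) n).1 ?_⟩
  change k < digLen b n
  omega

lemma concatTerm_zero (b : ℕ) (a : ℕ → ℕ) :
    concatTerm b a 0 = (a 0 : ℝ) / (b : ℝ) ^ digLen b (a 0) := by
  simp [concatTerm]

lemma concatTerm_succ (b : ℕ) (a : ℕ → ℕ) (i : ℕ) :
    concatTerm b a (i + 1) =
      concatTerm b (fun i => a (i + 1)) i / (b : ℝ) ^ digLen b (a 0) := by
  rw [concatTerm, concatTerm, Finset.sum_range_succ', pow_add, div_div]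

lemma concatTerm_nonneg (b : ℕ) (a : ℕ → ℕ) (i : ℕ) : 0 ≤ concatTerm b a i := by
  unfold concatTerm; positivity

lemma sum_concatTerm_le_one {b : ℕ} (hb : 2 ≤ b) (n : ℕ) (a : ℕ → ℕ) :
    ∑ i ∈ Finset.range n, concatTerm b a i ≤ 1 := by
  induction n generalizing a with
  | zero => simp
  | succ n ih =>
    rw [Finset.sum_range_succ']
    simp only [concatTerm_succ, concatTerm_zero]
    rw [← Finset.sum_div, ← add_div, div_le_one (by positivity)]
    have h1 : ((a 0 + 1 : ℕ) : ℝ) ≤ ((b ^ digLen b (a 0) : ℕ) : ℝ) :=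
      Nat.cast_le.2 (lt_pow_digLen hb (a 0))
    push_cast at h1
    linarith [ih fun i => a (i + 1)]

lemma summable_concatTerm {b : ℕ} (hb : 2 ≤ b) (a : ℕ → ℕ) : Summable (concatTerm b a) :=
  summable_of_sum_range_le (concatTerm_nonneg b a) fun n => sum_concatTerm_le_one hb n a

lemma tsum_concatTerm_bounds {b : ℕ} (hb : 2 ≤ b) {a : ℕ → ℕ} (ha : ∀ i, 0 < a i) :
    0 < ∑' i, concatTerm b a i ∧ ∑' i, concatTerm b a i ≤ 1 := by
  refine ⟨(summable_concatTerm hb a).tsum_pos (concatTerm_nonneg b a) 0 ?_,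
    (summable_concatTerm hb a).tsum_le_of_sum_range_le fun n => sum_concatTerm_le_one hb n a⟩
  have := ha 0
  rw [concatTerm_zero]
  positivity

lemma tsum_concatTerm_mul_pow {b : ℕ} (hb : 2 ≤ b) (a : ℕ → ℕ) :
    (∑' i, concatTerm b a i) * (b : ℝ) ^ digLen b (a 0) =
      a 0 + ∑' i, concatTerm b (fun i => a (i + 1)) i := by
  rw [(summable_concatTerm hb a).tsum_eq_zero_add, concatTerm_zero]
  simp only [concatTerm_succ]
  rw [tsum_div_const]
  field_simp

/-- The data about the first two partial quotients of a Trott number: the first one is a single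
digit, and the second one begins the remaining expansion `z`. -/
lemma IsTrottWith.first_two {b : ℕ} (hb : 2 ≤ b) {x : ℝ} {a : ℕ → ℕ} (h : IsTrottWith b x a) :
    ∃ z w : ℝ, ∃ k : ℕ, b * x = a 0 + z ∧ 0 < z ∧ z ≤ 1 ∧
      z * (b : ℝ) ^ (k + 1) = a 1 + w ∧ 0 < w ∧ w ≤ 1 ∧ b ^ k ≤ a 1 := by
  obtain ⟨ha, hcf, hx⟩ := h
  change x = ∑' i, concatTerm b a i at hx
  replace hcf : CfTendsto a x := hcf
  have hx0 := (hcf.bounds ha).1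
  have hxa : x * a 0 < 1 := by
    have := (hcf.remainder ha).1
    rw [sub_pos, lt_div_iff₀ hx0] at this
    linarith
  have ha' : ∀ i, 0 < a (i + 1) := fun i => ha _
  have e1 := tsum_concatTerm_mul_pow hb a
  have e2 := tsum_concatTerm_mul_pow hb fun i => a (i + 1)
  have b1 := tsum_concatTerm_bounds hb ha'
  have b2 := tsum_concatTerm_bounds hb (a := fun i => a (i + 1 + 1)) fun i => ha _
  rw [← hx] at e1
  obtain ⟨k, hk, hkl⟩ := exists_digLen_eq_succ hb (ha 0)
  obtain ⟨k', hk', hkl'⟩ := exists_digLen_eq_succ hb (ha 1)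
  simp only [zero_add] at e2
  rw [hk] at e1
  rw [hk'] at e2
  have ha0 : (0 : ℝ) < a 0 := by exact_mod_cast ha 0
  have hsq : (a 0 : ℝ) * a 0 < (b : ℝ) ^ (k + 1) := by
    have hp : (0 : ℝ) < (b : ℝ) ^ (k + 1) := by positivity
    nlinarith [mul_pos hp (sub_pos.2 hxa), mul_pos ha0 b1.1]
  have hsq' : a 0 * a 0 < b ^ (k + 1) := by exact_mod_cast hsq
  have hkk : b ^ (k + k) < b ^ (k + 1) := by
    rw [pow_add]
    exact lt_of_le_of_lt (Nat.mul_le_mul hkl hkl) hsq'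
  have hk0 : k = 0 := by
    have := (Nat.pow_lt_pow_iff_right (by omega : 1 < b)).1 hkk
    omega
  subst hk0
  exact ⟨_, _, k', by rw [← e1]; ring, b1.1, b1.2, e2, b2.1, b2.2, hkl'⟩

/-! ### Arithmetic of consecutive bases -/

/-- If `m * b ^ (k + 1) - (m + 1) * (b + 1) ^ (j + 1)` lies in the range forced by the Trott
conditions, then only base `7` with value `3` survives the congruences modulo `b` and `b + 1`. -/
lemma power_difference_restricted {a m : ℤ} (ha : 2 ≤ a) (hm : 1 ≤ m) (hm' : m + 1 ≤ 2 * a)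
    (k j : ℕ) {D : ℤ}
    (hD : D = m * (a ^ 2 + m) ^ (k + 1) - (m + 1) * (a ^ 2 + m + 1) ^ (j + 1))
    (hlo : -(a + 1) < D) (hhi : D < 2 * a ^ 2) : a = 2 ∧ m = 3 ∧ D = 3 := by
  have hmod : (a ^ 2 + m) ∣ D + (m + 1) := by
    have h1 : (a ^ 2 + m) ∣ (a ^ 2 + m + 1) ^ (j + 1) - 1 := by
      have := sub_dvd_pow_sub_pow (a ^ 2 + m + 1) 1 (j + 1)
      rwa [add_sub_cancel_right, one_pow] at this
    have h2 : (a ^ 2 + m) ∣ (a ^ 2 + m) ^ (k + 1) := dvd_pow_self _ (by omega)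
    have e : D + (m + 1) = m * (a ^ 2 + m) ^ (k + 1)
        - (m + 1) * ((a ^ 2 + m + 1) ^ (j + 1) - 1) := by rw [hD]; ring
    exact e ▸ dvd_sub (h2.mul_left m) (h1.mul_left (m + 1))
  have hmod' : (a ^ 2 + m + 1) ∣ D - m ∨ (a ^ 2 + m + 1) ∣ D + m := by
    have h1 : (a ^ 2 + m + 1) ∣ (a ^ 2 + m) ^ (k + 1) - (-1) ^ (k + 1) := by
      simpa only [sub_neg_eq_add] using sub_dvd_pow_sub_pow (a ^ 2 + m) (-1) (k + 1)
    have h2 : (a ^ 2 + m + 1) ∣ (a ^ 2 + m + 1) ^ (j + 1) := dvd_pow_self _ (by omega)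
    have h3 := dvd_sub (h1.mul_left m) (h2.mul_left (m + 1))
    have e : D - m * (-1) ^ (k + 1) = m * ((a ^ 2 + m) ^ (k + 1) - (-1) ^ (k + 1))
        - (m + 1) * (a ^ 2 + m + 1) ^ (j + 1) := by rw [hD]; ring
    rw [← e] at h3
    rcases neg_one_pow_eq_or ℤ (k + 1) with h | h <;> rw [h] at h3
    · left; rwa [mul_one] at h3
    · right; rwa [mul_neg_one, sub_neg_eq_add] at h3
  obtain ⟨q, hq⟩ := hmod
  have hq0 : -1 < q := by nlinarith
  have hq2 : q < 2 := by nlinarith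
  have hcases : D = -(m + 1) ∨ D = a ^ 2 - 1 := by
    have : q = 0 ∨ q = 1 := by omega
    rcases this with rfl | rfl
    · left; linarith
    · right; linarith
  rcases hcases with h | h <;> rcases hmod' with h' | h' <;> rw [h] at h'
  · have h2 := Int.le_of_dvd (by linarith) ((dvd_neg.2 h'))
    nlinarith
  · have h2 := Int.le_of_dvd (by linarith) ((dvd_neg.2 h'))
    nlinarith
  · have h3 : (a ^ 2 + m + 1) ∣ 2 * m + 2 :=
      (by ring : 2 * m + 2 = a ^ 2 + m + 1 - (a ^ 2 - 1 - m)) ▸ dvd_sub_self_left.2 h'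
    have h2 := Int.le_of_dvd (by linarith) h3
    have ha2 : a = 2 := by nlinarith
    subst ha2
    refine ⟨rfl, by linarith, by rw [h]; norm_num⟩
  · have h3 : (a ^ 2 + m + 1) ∣ 2 :=
      (by ring : (2 : ℤ) = a ^ 2 + m + 1 - (a ^ 2 - 1 + m)) ▸ dvd_sub_self_left.2 h'
    have h2 := Int.le_of_dvd (by norm_num) h3
    nlinarith

/-- The second partial quotient cannot have two digits in base `β = a ^ 2 + m`. -/
lemma two_digit_quotient_impossible {a m β y N : ℝ} (ha : 2 ≤ a) (hm : 1 ≤ m)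
    (hβ : β = a ^ 2 + m) (hy0 : 0 < y) (hy1 : y < 1) (hβN : β ≤ N) (hyN : y * N < 1)
    (hD : m * β ^ 2 - (m + 1) * (β + 1) < a + y + a * (y * (β ^ 2 - (β + 1)))) : False := by
  have hβa : a ^ 2 + 1 ≤ β := by linarith
  have hβ5 : 5 ≤ β := by nlinarith
  have hyβ : y * β < 1 := lt_of_le_of_lt (mul_le_mul_of_nonneg_left hβN hy0.le) hyN
  have h1 : y * (β ^ 2 - (β + 1)) < β - 1 := by
    nlinarith [mul_pos (show 0 < β - 1 by linarith) (sub_pos.2 hyβ)]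
  have h2 : a * (y * (β ^ 2 - (β + 1))) ≤ a * (β - 1) :=
    mul_le_mul_of_nonneg_left h1.le (by linarith)
  have h3 : 0 ≤ (m - 1) * (β ^ 2 - β - 1) := mul_nonneg (by linarith) (by nlinarith)
  have h4 : 1 ≤ β - 2 - a := by nlinarith
  have h5 : β * 1 ≤ β * (β - 2 - a) := mul_le_mul_of_nonneg_left h4 (by linarith)
  nlinarith

/-- If the second partial quotient has at least three digits, the difference of scaled powers is
below `2 * a ^ 2`, and it is not `3` in base `7`. -/
lemma power_difference_lt {a m y N w B C : ℝ} (ha : 2 ≤ a) (hm : 1 ≤ m) (hy0 : 0 < y)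
    (hyN : y * N < 1) (hw : w ≤ 1) (hC : 0 < C) (hCB : C < B) (hN : (a ^ 2 + m) ^ 2 ≤ N)
    (eB : B * (m - a * y) = (a + y) * (N + w))
    (hD : m * B - (m + 1) * C < a + y + a * (y * (B - C))) :
    m * B - (m + 1) * C < 2 * a ^ 2 ∧ ¬ (a = 2 ∧ m = 3 ∧ m * B - (m + 1) * C = 3) := by
  have h5 : 5 ≤ a ^ 2 + m := by nlinarith
  have hN25 : 25 ≤ N := by nlinarith
  have hy25 : y < 1 / 25 := by nlinarith
  have hay : a * y < 2 / 25 := by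
    have h1 : 25 / 2 * a ≤ N := by nlinarith
    have h2 : y * (25 / 2 * a) ≤ y * N := mul_le_mul_of_nonneg_left h1 hy0.le
    linarith
  have hu : 0 < a + y := by linarith
  have hyB : y * B * (m - a * y) ≤ (a + y) * (1 + y) := by
    have h1 : y * B * (m - a * y) = (a + y) * (y * N + y * w) := by linear_combination y * eB
    have h2 : y * w ≤ y * 1 := mul_le_mul_of_nonneg_left hw hy0.le
    rw [h1]
    exact mul_le_mul_of_nonneg_left (by linarith) hu.le
  have hyB0 : 0 < y * B := mul_pos hy0 (hC.trans hCB)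
  constructor
  · have h1 : y * B * (23 / 25) ≤ (a + 1 / 25) * (26 / 25) := by
      have e1 : y * B * (23 / 25) ≤ y * B * (m - a * y) :=
        mul_le_mul_of_nonneg_left (by linarith) hyB0.le
      have e2 : (a + y) * (1 + y) ≤ (a + 1 / 25) * (26 / 25) :=
        mul_le_mul (by linarith) (by linarith) (by linarith) (by linarith)
      linarith
    have h2 : y * (B - C) ≤ y * B := mul_le_mul_of_nonneg_left (by linarith) hy0.le
    have h3 : a * (y * (B - C)) ≤ a * ((a + 1 / 25) * (26 / 23)) :=
      mul_le_mul_of_nonneg_left (by linarith) (by linarith)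
    nlinarith
  · rintro ⟨rfl, rfl, h3⟩
    have hN49 : 49 ≤ N := by linarith
    have hy49 : y < 1 / 49 := by nlinarith
    have hyC : y * C = 3 / 4 * (y * B) - 3 / 4 * y := by linear_combination -y / 4 * h3
    have e1 : y * B * (29 / 10) ≤ y * B * (3 - 2 * y) :=
      mul_le_mul_of_nonneg_left (by linarith) hyB0.le
    have e2 : (2 + y) * (1 + y) ≤ (2 + 1 / 49) * (1 + 1 / 49) :=
      mul_le_mul (by linarith) (by linarith) (by linarith) (by linarith)
    linarith

/-- No pair of first partial quotients `a`, `N` is compatible with both bases. -/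
lemma no_common_first_two {b a N k j : ℕ} {x y z z' w w' : ℝ} (hb : 2 ≤ b) (ha : 1 ≤ a)
    (hx : x * (a + y) = 1) (hy0 : 0 < y) (hy1 : y < 1) (hyN : y * N < 1)
    (hz : b * x = a + z) (hz0 : 0 < z) (hzw : z * (b : ℝ) ^ (k + 1) = N + w)
    (hw0 : 0 < w) (hw1 : w ≤ 1) (hbN : b ^ k ≤ N)
    (hz' : ((b : ℝ) + 1) * x = a + z') (hz1' : z' ≤ 1)
    (hzw' : z' * ((b : ℝ) + 1) ^ (j + 1) = N + w')
    (hw0' : 0 < w') (hw1' : w' ≤ 1) : False := by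
  have haR : (1 : ℝ) ≤ a := by exact_mod_cast ha
  have hu : (0 : ℝ) < a + y := by linarith
  have hx0 : 0 < x := pos_of_mul_pos_left (hx ▸ one_pos) hu.le
  have eb : (b : ℝ) = (a + z) * (a + y) := by
    rw [← hz]; linear_combination (-(b : ℝ)) * hx
  have eb' : (b : ℝ) + 1 = (a + z') * (a + y) := by
    rw [← hz']; linear_combination (-((b : ℝ) + 1)) * hx
  have hlow : a ^ 2 < b := by
    have : (a : ℝ) ^ 2 < b := by rw [eb]; nlinarith [mul_pos hz0 hy0]
    exact_mod_cast this
  have hupp : b + 1 < (a + 1) ^ 2 := by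
    have h1 : (a + z') * (a + y) ≤ (a + 1) * (a + y) :=
      mul_le_mul_of_nonneg_right (by linarith) hu.le
    have : (b : ℝ) + 1 < ((a : ℝ) + 1) ^ 2 := by nlinarith
    exact_mod_cast this
  have hab : a < b := by nlinarith
  have habR : (a : ℝ) < b := by exact_mod_cast hab
  set B : ℝ := (b : ℝ) ^ (k + 1) with hB
  set C : ℝ := ((b : ℝ) + 1) ^ (j + 1) with hC
  have hC0 : 0 < C := by positivity
  have hCb : (b : ℝ) + 1 ≤ C := le_self_pow₀ (by linarith) (by omega)
  have hCB : C < B := by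
    by_contra! hBC
    have h1 : x * C < 1 := by
      have h2 : z * B ≤ z * C := mul_le_mul_of_nonneg_left hBC hz0.le
      have h3 : z' * C = z * C + x * C := by linear_combination C * hz - C * hz'
      linarith
    have h2 : x * (a + y) ≤ x * C := mul_le_mul_of_nonneg_left (by linarith) hx0.le
    linarith
  obtain ⟨m, rfl⟩ : ∃ m, b = a ^ 2 + m := ⟨b - a ^ 2, by omega⟩
  have hm : 1 ≤ m := by omega
  have hm' : m + 1 ≤ 2 * a := by nlinarith
  obtain ⟨k, rfl⟩ : ∃ i, k = i + 1 := by
    apply Nat.exists_eq_succ_of_ne_zero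
    rintro rfl
    simp only [hB, zero_add, pow_one] at hCB
    linarith
  have hbleN : a ^ 2 + m ≤ N := le_trans (Nat.le_self_pow (by omega) _) hbN
  obtain rfl | ha2 := eq_or_lt_of_le ha
  · obtain rfl : m = 1 := by omega
    norm_num at eb'
    have hN2 : (2 : ℝ) ≤ N := by exact_mod_cast hbleN
    have h1 : (1 + z') * (1 + y) ≤ 2 * (1 + y) :=
      mul_le_mul_of_nonneg_right (by linarith) (by linarith)
    have h2 : y * 2 ≤ y * N := mul_le_mul_of_nonneg_left hN2 hy0.le
    linarith
  replace ha2 : 2 ≤ a := ha2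
  have ha2R : (2 : ℝ) ≤ a := by exact_mod_cast ha2
  have hmR : (1 : ℝ) ≤ m := by exact_mod_cast hm
  push_cast at eb eb' hB hC
  have eB : B * (m - a * y) = (a + y) * (N + w) := by
    rw [← hzw]; linear_combination B * eb
  have eC : C * (m + 1 - a * y) = (a + y) * (N + w') := by
    rw [← hzw']; linear_combination C * eb'
  have eD : m * B - (m + 1) * C = (a + y) * (w - w') + a * y * (B - C) := by
    linear_combination eB - eC
  have hDlo : -((a : ℝ) + 1) < m * B - (m + 1) * C := by
    have h1 : 0 < a * y * (B - C) := mul_pos (by positivity) (sub_pos.2 hCB)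
    have h2 : (a + y) * (-1) ≤ (a + y) * (w - w') :=
      mul_le_mul_of_nonneg_left (by linarith) hu.le
    linarith
  have hDhi : m * B - (m + 1) * C < a + y + a * (y * (B - C)) := by
    have h2 : (a + y) * (w - w') < (a + y) * 1 := mul_lt_mul_of_pos_left (by linarith) hu
    rw [eD]
    linarith
  obtain rfl | hk := Nat.eq_zero_or_pos k
  · have hj : j = 0 := by
      by_contra hj
      have h1 : ((a : ℝ) ^ 2 + m + 1) ^ 2 ≤ C := by
        rw [hC]
        exact pow_le_pow_right₀ (by linarith [sq_nonneg (a : ℝ)]) (by omega)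
      have h2 : ((a : ℝ) ^ 2 + m) ^ 2 ≤ ((a : ℝ) ^ 2 + m + 1) ^ 2 :=
        pow_le_pow_left₀ (by positivity) (by linarith) 2
      norm_num at hB
      linarith
    subst hj
    norm_num at hB hC
    rw [hB, hC] at hDhi
    exact two_digit_quotient_impossible ha2R hmR rfl hy0 hy1 (by exact_mod_cast hbleN) hyN hDhi
  have hN2 : (a ^ 2 + m) ^ 2 ≤ N := le_trans (Nat.pow_le_pow_right (by omega) (by omega)) hbN
  obtain ⟨hDgen, hD7⟩ := power_difference_lt ha2R hmR hy0 hyN hw1 hC0 hCB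
    (by exact_mod_cast hN2) eB hDhi
  obtain ⟨h1, h2, h3⟩ := power_difference_restricted (a := a) (m := m) (by exact_mod_cast ha2)
    (by exact_mod_cast hm) (by exact_mod_cast hm') (k + 1) j rfl
    (by rw [hB, hC] at hDlo; exact_mod_cast hDlo) (by rw [hB, hC] at hDgen; exact_mod_cast hDgen)
  exact hD7 ⟨by exact_mod_cast h1, by exact_mod_cast h2, by rw [hB, hC]; exact_mod_cast h3⟩

/-- For any `b ≥ 2`, no number is Trott in both base `b` and base `b+1`. -/
theorem trott_not_consecutive_bases (b : ℕ) (hb : 2 ≤ b) :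
    TrottSet b ∩ TrottSet (b + 1) = ∅ := by
  rw [Set.eq_empty_iff_forall_notMem]
  rintro x ⟨⟨a, h⟩, ⟨c, h'⟩⟩
  obtain ⟨z, w, k, hz, hz0, -, hzw, hw0, hw1, hbN⟩ := h.first_two hb
  obtain ⟨z', w', j, hz', -, hz1', hzw', hw0', hw1', -⟩ := h'.first_two (by omega)
  obtain ⟨ha, hcf, -⟩ := h
  obtain ⟨hc, hcf', -⟩ := h'
  replace hcf : CfTendsto a x := hcf
  replace hcf' : CfTendsto c x := hcf'
  have e0 : c 0 = a 0 := hcf'.head_unique hc hcf ha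
  have hs := hcf.shift ha
  have hs' := hcf'.shift hc
  rw [e0] at hz' hs'
  have e1 : c 1 = a 1 := hs'.head_unique (fun i => hc _) hs fun i => ha _
  rw [e1] at hzw'
  push_cast at hz' hzw'
  obtain ⟨hy0, hy1⟩ := hcf.remainder ha
  have hx0 := (hcf.bounds ha).1
  have hr := (hs.remainder fun i => ha _).1
  rw [sub_pos, lt_div_iff₀ hy0, mul_comm] at hr
  exact no_common_first_two hb (ha 0) (by field_simp; ring) hy0 hy1 hr hz hz0 hzw hw0 hw1 hbN
    hz' hz1' hzw' hw0' hw1'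
end
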